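/- Converse purity-rate bound: Consider any (n,R,P,ε) local purity distillation protocol for a bipartite state ρ^{AB} on systems of dimensions d_A, d_B, and set δ = 2/(en) + ε log(d_A d_B). Let Y denote the register that Alice inputs to the dephasing channel, with mutual information evaluated on the state U_A((ρ^{AB})^{⊗n} ⊗ |0⟩⟨0|^C). Then the purity rate satisfies P ≤ κ(ρ^A) + κ(ρ^B) + (1/n) I(Y;B^n) + δ. -/

import Mathlib

noncomputable section
namespace LPD

open Matrix Kronecker BigOperators Filter Finset
open scoped ComplexOrder

/-- The positive semidefinite square root of a positive semidefinite matrix (the former Mathlib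
definition `Matrix.PosSemidef.sqrt`, since removed). -/
def _root_.Matrix.PosSemidef.sqrt {m 𝕜 : Type*} [Fintype m] [RCLike 𝕜] [DecidableEq m]
    {A : Matrix m m 𝕜} (hA : A.PosSemidef) : Matrix m m 𝕜 :=
  hA.1.eigenvectorUnitary.1 * diagonal ((↑) ∘ Real.sqrt ∘ hA.1.eigenvalues) *
    (star hA.1.eigenvectorUnitary : Matrix m m 𝕜)

/-- The trace norm `‖ω‖₁ = Tr √(ωᴴ ω)` of a matrix. -/
def traceNorm {ι : Type*} [Fintype ι] [DecidableEq ι] (ω : Matrix ι ι ℂ) : ℝ :=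
  ((Matrix.posSemidef_conjTranspose_mul_self ω).sqrt).trace.re

/-- A density operator: positive semidefinite with trace one. -/
def IsDensity {ι : Type*} [Fintype ι] (ρ : Matrix ι ι ℂ) : Prop :=
  ρ.PosSemidef ∧ ρ.trace = 1

/-- The von Neumann entropy `H(ρ) = -Tr(ρ log ρ)`, expressed via eigenvalues
(with the convention `0 log 0 = 0`, and junk value `0` on non-Hermitian input). -/
def entropy {ι : Type*} [Fintype ι] [DecidableEq ι] (ρ : Matrix ι ι ℂ) : ℝ :=
  letI := Classical.dec ρ.IsHermitian
  if h : ρ.IsHermitian then -∑ i, h.eigenvalues i * Real.log (h.eigenvalues i) else 0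

/-- Partial trace over the first (left) tensor factor. -/
def ptraceLeft {α β : Type*} [Fintype α] (ρ : Matrix (α × β) (α × β) ℂ) : Matrix β β ℂ :=
  fun b b' => ∑ a, ρ (a, b) (a, b')

/-- Partial trace over the second (right) tensor factor. -/
def ptraceRight {α β : Type*} [Fintype β] (ρ : Matrix (α × β) (α × β) ℂ) : Matrix α α ℂ :=
  fun a a' => ∑ b, ρ (a, b) (a', b)

/-- Quantum mutual information `I(A;B) = H(A) + H(B) - H(AB)` of a bipartite state. -/
def mutualInfo {α β : Type*} [Fintype α] [DecidableEq α] [Fintype β] [DecidableEq β]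
    (ρ : Matrix (α × β) (α × β) ℂ) : ℝ :=
  entropy (ptraceRight ρ) + entropy (ptraceLeft ρ) - entropy ρ

/-- Conditional entropy `H(B|A) = H(AB) - H(A)` (second system conditioned on the first). -/
def condEntropySnd {α β : Type*} [Fintype α] [DecidableEq α] [Fintype β] [DecidableEq β]
    (ρ : Matrix (α × β) (α × β) ℂ) : ℝ :=
  entropy ρ - entropy (ptraceRight ρ)

/-- Conditional entropy `H(A|B) = H(AB) - H(B)` (first system conditioned on the second). -/
def condEntropyFst {α β : Type*} [Fintype α] [DecidableEq α] [Fintype β] [DecidableEq β]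
    (ρ : Matrix (α × β) (α × β) ℂ) : ℝ :=
  entropy ρ - entropy (ptraceLeft ρ)

/-- `n`-fold tensor power of a matrix. -/
def tpow {ι : Type*} (ρ : Matrix ι ι ℂ) (n : ℕ) : Matrix (Fin n → ι) (Fin n → ι) ℂ :=
  fun x y => ∏ k, ρ (x k) (y k)

/-- `n`-fold tensor power of a bipartite state, with the `A` and `B` factors collected. -/
def tpowAB {α β : Type*} (ρ : Matrix (α × β) (α × β) ℂ) (n : ℕ) :
    Matrix ((Fin n → α) × (Fin n → β)) ((Fin n → α) × (Fin n → β)) ℂ :=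
  Matrix.reindex (Equiv.arrowProdEquivProdArrow (Fin n) (fun _ => α) (fun _ => β))
    (Equiv.arrowProdEquivProdArrow (Fin n) (fun _ => α) (fun _ => β)) (tpow ρ n)

/-- A POVM on the system `ι` with outcome set `κ`. -/
structure POVM (ι κ : Type*) [Fintype ι] [DecidableEq ι] [Fintype κ] where
  elem : κ → Matrix ι ι ℂ
  pos : ∀ y, (elem y).PosSemidef
  sum_eq : ∑ y, elem y = 1

/-- Apply a POVM to the first factor of a bipartite state, recording the outcome in a
classical register: `ρ^{AΓ} ↦ Σ_y |y⟩⟨y| ⊗ Tr_A((Λ_y ⊗ 1)ρ)`. -/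
def measureLeft {ι κ γ : Type*} [Fintype ι] [DecidableEq ι] [Fintype κ] [DecidableEq κ]
    (Λ : POVM ι κ) (ρ : Matrix (ι × γ) (ι × γ) ℂ) : Matrix (κ × γ) (κ × γ) ℂ :=
  fun p q => if p.1 = q.1 then ∑ a, ∑ a', (Λ.elem p.1) a a' * ρ (a', p.2) (a, q.2) else 0

/-- The canonical purification of a density operator `ρ` on `ι`, a pure state on `ι × ι`
(junk value `0` for non-positive-semidefinite input). -/
def canonicalPurification {ι : Type*} [Fintype ι] [DecidableEq ι] (ρ : Matrix ι ι ℂ) :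
    Matrix (ι × ι) (ι × ι) ℂ :=
  letI := Classical.dec ρ.PosSemidef
  if h : ρ.PosSemidef then
    vecMulVec (fun p => h.sqrt p.1 p.2) (star fun p => h.sqrt p.1 p.2)
  else 0

/-- The purity `κ(ρ) = log d - H(ρ)`. -/
def kappa {ι : Type*} [Fintype ι] [DecidableEq ι] (ρ : Matrix ι ι ℂ) : ℝ :=
  Real.log (Fintype.card ι) - entropy ρ

/-- The pure state `|0⟩⟨0|` on a `d`-dimensional system. -/
def pureZero (d : ℕ) : Matrix (Fin d) (Fin d) ℂ :=
  fun i j => if i.val = 0 ∧ j.val = 0 then 1 else 0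

/-! ### Index bookkeeping equivalences -/

/-- `(a × b) × c ≃ (a × c) × b`. -/
def swapE (a b c : Type*) : (a × b) × c ≃ (a × c) × b where
  toFun x := ((x.1.1, x.2), x.1.2)
  invFun x := ((x.1.1, x.2), x.1.2)
  left_inv _ := rfl
  right_inv _ := rfl

/-- Pull the `Y` register to the front: `((a × y) × g) × b ≃ y × ((a × g) × b)`. -/
def pullY (a y g b : Type*) : ((a × y) × g) × b ≃ y × ((a × g) × b) where
  toFun x := (x.1.1.2, ((x.1.1.1, x.1.2), x.2))
  invFun x := (((x.2.1.1, x.1), x.2.1.2), x.2.2)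
  left_inv _ := rfl
  right_inv _ := rfl

/-- Rearrange for Bob's unitary: `((a × y) × g) × b ≃ (b × y) × (a × g)`. -/
def pullBY (a y g b : Type*) : ((a × y) × g) × b ≃ (b × y) × (a × g) where
  toFun x := ((x.2, x.1.1.2), (x.1.1.1, x.1.2))
  invFun x := (((x.2.1, x.1.2), x.2.2), x.1.1)
  left_inv _ := rfl
  right_inv _ := rfl

/-- Collect `Y` and `B` together: `((a × y) × g) × b ≃ (y × b) × (a × g)`. -/
def pullYB (a y g b : Type*) : ((a × y) × g) × b ≃ (y × b) × (a × g) where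
  toFun x := ((x.1.1.2, x.2), (x.1.1.1, x.1.2))
  invFun x := (((x.2.1, x.1.1), x.2.2), x.1.2)
  left_inv _ := rfl
  right_inv _ := rfl

/-- Sort output registers: `(bp × bg) × (ap × ag) ≃ (ap × bp) × (ag × bg)`. -/
def sortOut (bp bg ap ag : Type*) : (bp × bg) × (ap × ag) ≃ (ap × bp) × (ag × bg) where
  toFun x := ((x.2.1, x.1.1), (x.2.2, x.1.2))
  invFun x := ((x.1.2, x.2.2), (x.1.1, x.2.1))
  left_inv _ := rfl
  right_inv _ := rfl

/-- `y × (x × w) ≃ (y × w) × x`. -/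
def exYW (y x w : Type*) : y × (x × w) ≃ (y × w) × x where
  toFun a := ((a.1, a.2.2), a.2.1)
  invFun a := (a.1.1, (a.2, a.1.2))
  left_inv _ := rfl
  right_inv _ := rfl

/-- `y × (x × w) ≃ (y × x) × w`. -/
def exYX (y x w : Type*) : y × (x × w) ≃ (y × x) × w where
  toFun a := ((a.1, a.2.1), a.2.2)
  invFun a := (a.1.1, (a.1.2, a.2))
  left_inv _ := rfl
  right_inv _ := rfl

/-- `y × (x × (b × e)) ≃ (y × b) × (x × e)`. -/
def exYB (y x b e : Type*) : y × (x × (b × e)) ≃ (y × b) × (x × e) where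
  toFun a := ((a.1, a.2.2.1), (a.2.1, a.2.2.2))
  invFun a := (a.1.1, (a.2.1, (a.1.2, a.2.2)))
  left_inv _ := rfl
  right_inv _ := rfl

/-! ### The state `σ^{YBE}` obtained by measuring Alice's share of a purification -/

/-- The canonical purification of a bipartite state `ρ^{AB}`, with indices arranged as
`A × (B × E)` where `E = A × B`. -/
def purifyAssoc {α β : Type*} [Fintype α] [DecidableEq α] [Fintype β] [DecidableEq β]
    (ρ : Matrix (α × β) (α × β) ℂ) :
    Matrix (α × (β × (α × β))) (α × (β × (α × β))) ℂ :=
  Matrix.reindex (Equiv.prodAssoc α β (α × β)) (Equiv.prodAssoc α β (α × β))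
    (canonicalPurification ρ)

/-- `σ^{YBE} = (Λ ⊗ 1^{BE})(Ψ^{ABE})` for the canonical purification `Ψ` of `ρ^{AB}`. -/
def sigmaOf {α β κ : Type*} [Fintype α] [DecidableEq α] [Fintype β] [DecidableEq β]
    [Fintype κ] [DecidableEq κ] (ρ : Matrix (α × β) (α × β) ℂ) (Λ : POVM α κ) :
    Matrix (κ × (β × (α × β))) (κ × (β × (α × β))) ℂ :=
  measureLeft Λ (purifyAssoc ρ)

/-- `I(Y;B)` evaluated on a state of the form `σ^{Y(BE)}`: trace out `E`, then take the
mutual information. -/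
def IYB {κ β ε : Type*} [Fintype κ] [DecidableEq κ] [Fintype β] [DecidableEq β] [Fintype ε]
    (σ : Matrix (κ × (β × ε)) (κ × (β × ε)) ℂ) : ℝ :=
  mutualInfo (ptraceRight (Matrix.reindex (Equiv.prodAssoc κ β ε).symm
    (Equiv.prodAssoc κ β ε).symm σ))

/-- `I(Y;BE)` evaluated on a state of the form `σ^{Y(BE)}`. -/
def IYBE {κ β ε : Type*} [Fintype κ] [DecidableEq κ] [Fintype β] [DecidableEq β] [Fintype ε]
    [DecidableEq ε] (σ : Matrix (κ × (β × ε)) (κ × (β × ε)) ℂ) : ℝ :=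
  mutualInfo σ

/-- `P^{(1)}_→(ρ^{AB}, R) = max_Λ { I(Y;B)_σ : I(Y;BE)_σ ≤ R }`, the maximum over all
POVMs on Alice's system. -/
def P1 {α β : Type*} [Fintype α] [DecidableEq α] [Fintype β] [DecidableEq β]
    (ρ : Matrix (α × β) (α × β) ℂ) (R : ℝ) : ℝ :=
  sSup { v : ℝ | ∃ (m : ℕ) (Λ : POVM α (Fin m)),
    IYBE (sigmaOf ρ Λ) ≤ R ∧ v = IYB (sigmaOf ρ Λ) }

/-! ### Local purity distillation protocols -/

/-- An `(n, ·, ·, ·)` local purity distillation protocol: Alice's unitary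
`U_A : H_{A^n} ⊗ H_C → H_{A_p} ⊗ H_Y ⊗ H_{A_g}`, a dephasing channel on `Y`
(applied below), and Bob's unitary `U_B : H_{B^n} ⊗ H_Y → H_{B_p} ⊗ H_{B_g}`. -/
structure Protocol (α β : Type*) [Fintype α] [DecidableEq α] [Fintype β] [DecidableEq β]
    (n : ℕ) where
  dC : ℕ
  dAp : ℕ
  dY : ℕ
  dAg : ℕ
  dBp : ℕ
  dBg : ℕ
  dC_pos : 0 < dC
  dAp_pos : 0 < dAp
  dY_pos : 0 < dY
  dAg_pos : 0 < dAg
  dBp_pos : 0 < dBp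
  dBg_pos : 0 < dBg
  UA : Matrix ((Fin dAp × Fin dY) × Fin dAg) ((Fin n → α) × Fin dC) ℂ
  UA_unitary : UAᴴ * UA = 1 ∧ UA * UAᴴ = 1
  UB : Matrix (Fin dBp × Fin dBg) ((Fin n → β) × Fin dY) ℂ
  UB_unitary : UBᴴ * UB = 1 ∧ UB * UBᴴ = 1

variable {α β : Type*} [Fintype α] [DecidableEq α] [Fintype β] [DecidableEq β]

/-- The input state `(ρ^{AB})^{⊗n} ⊗ |0⟩⟨0|^C`, arranged as `(A^n × C) × B^n`. -/
def inputState (ρ : Matrix (α × β) (α × β) ℂ) {n : ℕ} (Pr : Protocol α β n) :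
    Matrix (((Fin n → α) × Fin Pr.dC) × (Fin n → β))
      (((Fin n → α) × Fin Pr.dC) × (Fin n → β)) ℂ :=
  Matrix.reindex (swapE (Fin n → α) (Fin n → β) (Fin Pr.dC))
    (swapE (Fin n → α) (Fin n → β) (Fin Pr.dC)) (tpowAB ρ n ⊗ₖ pureZero Pr.dC)

/-- The state `U_A((ρ^{AB})^{⊗n} ⊗ |0⟩⟨0|^C)` (before dephasing), on
`((A_p × Y) × A_g) × B^n`. -/
def stateAfterUA (ρ : Matrix (α × β) (α × β) ℂ) {n : ℕ} (Pr : Protocol α β n) :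
    Matrix (((Fin Pr.dAp × Fin Pr.dY) × Fin Pr.dAg) × (Fin n → β))
      (((Fin Pr.dAp × Fin Pr.dY) × Fin Pr.dAg) × (Fin n → β)) ℂ :=
  (Pr.UA ⊗ₖ (1 : Matrix (Fin n → β) (Fin n → β) ℂ)) * inputState ρ Pr *
    (Pr.UA ⊗ₖ (1 : Matrix (Fin n → β) (Fin n → β) ℂ))ᴴ

/-- Dephase the first tensor factor in a fixed basis. -/
def dephaseFst {κ γ : Type*} [DecidableEq κ] (ρ : Matrix (κ × γ) (κ × γ) ℂ) :
    Matrix (κ × γ) (κ × γ) ℂ :=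
  fun p q => if p.1 = q.1 then ρ p q else 0

/-- The state after Alice's unitary and the dephasing channel on `Y`. -/
def stateAfterDephasing (ρ : Matrix (α × β) (α × β) ℂ) {n : ℕ} (Pr : Protocol α β n) :
    Matrix (((Fin Pr.dAp × Fin Pr.dY) × Fin Pr.dAg) × (Fin n → β))
      (((Fin Pr.dAp × Fin Pr.dY) × Fin Pr.dAg) × (Fin n → β)) ℂ :=
  Matrix.reindex (pullY (Fin Pr.dAp) (Fin Pr.dY) (Fin Pr.dAg) (Fin n → β)).symm
    (pullY (Fin Pr.dAp) (Fin Pr.dY) (Fin Pr.dAg) (Fin n → β)).symm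
    (dephaseFst (Matrix.reindex (pullY (Fin Pr.dAp) (Fin Pr.dY) (Fin Pr.dAg) (Fin n → β))
      (pullY (Fin Pr.dAp) (Fin Pr.dY) (Fin Pr.dAg) (Fin n → β)) (stateAfterUA ρ Pr)))

/-- The final state `Υ`, after Bob's unitary, on `(B_p × B_g) × (A_p × A_g)`. -/
def stateAfterUB (ρ : Matrix (α × β) (α × β) ℂ) {n : ℕ} (Pr : Protocol α β n) :
    Matrix ((Fin Pr.dBp × Fin Pr.dBg) × (Fin Pr.dAp × Fin Pr.dAg))
      ((Fin Pr.dBp × Fin Pr.dBg) × (Fin Pr.dAp × Fin Pr.dAg)) ℂ :=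
  (Pr.UB ⊗ₖ (1 : Matrix (Fin Pr.dAp × Fin Pr.dAg) (Fin Pr.dAp × Fin Pr.dAg) ℂ)) *
    Matrix.reindex (pullBY (Fin Pr.dAp) (Fin Pr.dY) (Fin Pr.dAg) (Fin n → β))
      (pullBY (Fin Pr.dAp) (Fin Pr.dY) (Fin Pr.dAg) (Fin n → β)) (stateAfterDephasing ρ Pr) *
    (Pr.UB ⊗ₖ (1 : Matrix (Fin Pr.dAp × Fin Pr.dAg) (Fin Pr.dAp × Fin Pr.dAg) ℂ))ᴴ

/-- The reduced output state `Υ^{A_p B_p}`. -/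
def outputReduced (ρ : Matrix (α × β) (α × β) ℂ) {n : ℕ} (Pr : Protocol α β n) :
    Matrix (Fin Pr.dAp × Fin Pr.dBp) (Fin Pr.dAp × Fin Pr.dBp) ℂ :=
  ptraceRight (Matrix.reindex
    (sortOut (Fin Pr.dBp) (Fin Pr.dBg) (Fin Pr.dAp) (Fin Pr.dAg))
    (sortOut (Fin Pr.dBp) (Fin Pr.dBg) (Fin Pr.dAp) (Fin Pr.dAg)) (stateAfterUB ρ Pr))

/-- The error of a protocol: trace distance of `Υ^{A_p B_p}` from `|0⟩⟨0| ⊗ |0⟩⟨0|`. -/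
def protocolError (ρ : Matrix (α × β) (α × β) ℂ) {n : ℕ} (Pr : Protocol α β n) : ℝ :=
  traceNorm (outputReduced ρ Pr - pureZero Pr.dAp ⊗ₖ pureZero Pr.dBp)

/-- The classical communication rate `(1/n) log d_Y` of a protocol. -/
def commRate {n : ℕ} (Pr : Protocol α β n) : ℝ := Real.log Pr.dY / n

/-- The purity rate `(1/n)(log d_{A_p}d_{B_p} - log d_C)` of a protocol. -/
def purityRate {n : ℕ} (Pr : Protocol α β n) : ℝ :=
  (Real.log (Pr.dAp * Pr.dBp) - Real.log Pr.dC) / n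

/-- Achievability of a rate pair `(P, R)`: for all `ε, δ > 0` and all sufficiently large `n`
there is an `(n, R+δ, P-δ, ε)` protocol. -/
def Achievable (ρ : Matrix (α × β) (α × β) ℂ) (P R : ℝ) : Prop :=
  ∀ ε > (0 : ℝ), ∀ δ > (0 : ℝ), ∃ N : ℕ, ∀ n ≥ N, ∃ Pr : Protocol α β n,
    commRate Pr ≤ R + δ ∧ P - δ ≤ purityRate Pr ∧ protocolError ρ Pr ≤ ε

/-- The 1-way distillable local purity `κ_→(ρ^{AB}, R)`. -/
def kappaArrow (ρ : Matrix (α × β) (α × β) ℂ) (R : ℝ) : ℝ :=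
  sSup { P : ℝ | Achievable ρ P R }

/-- `I(Y;B^n)` on the pre-dephasing state `U_A((ρ^{AB})^{⊗n} ⊗ |0⟩⟨0|^C)`. -/
def preDephIYB (ρ : Matrix (α × β) (α × β) ℂ) {n : ℕ} (Pr : Protocol α β n) : ℝ :=
  mutualInfo (ptraceRight (Matrix.reindex
    (pullYB (Fin Pr.dAp) (Fin Pr.dY) (Fin Pr.dAg) (Fin n → β))
    (pullYB (Fin Pr.dAp) (Fin Pr.dY) (Fin Pr.dAg) (Fin n → β)) (stateAfterUA ρ Pr)))

/-- The pre-dephasing state together with the purifying environment `E^n`: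
`(U_A ⊗ 1^{B^nE^n})((Ψ^{ABE})^{⊗n} ⊗ |0⟩⟨0|^C)`, where `Ψ` is the canonical purification. -/
def preDephWithEnv (ρ : Matrix (α × β) (α × β) ℂ) {n : ℕ} (Pr : Protocol α β n) :
    Matrix (((Fin Pr.dAp × Fin Pr.dY) × Fin Pr.dAg) × (Fin n → β × (α × β)))
      (((Fin Pr.dAp × Fin Pr.dY) × Fin Pr.dAg) × (Fin n → β × (α × β))) ℂ :=
  (Pr.UA ⊗ₖ (1 : Matrix (Fin n → β × (α × β)) (Fin n → β × (α × β)) ℂ)) *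
    Matrix.reindex (swapE (Fin n → α) (Fin n → β × (α × β)) (Fin Pr.dC))
      (swapE (Fin n → α) (Fin n → β × (α × β)) (Fin Pr.dC))
      (tpowAB (purifyAssoc ρ) n ⊗ₖ pureZero Pr.dC) *
    (Pr.UA ⊗ₖ (1 : Matrix (Fin n → β × (α × β)) (Fin n → β × (α × β)) ℂ))ᴴ

/-- `I(Y;B^nE^n)` on the pre-dephasing state, including the purifying environment. -/
def preDephIYBE (ρ : Matrix (α × β) (α × β) ℂ) {n : ℕ} (Pr : Protocol α β n) : ℝ :=
  mutualInfo (ptraceRight (Matrix.reindex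
    (pullYB (Fin Pr.dAp) (Fin Pr.dY) (Fin Pr.dAg) (Fin n → β × (α × β)))
    (pullYB (Fin Pr.dAp) (Fin Pr.dY) (Fin Pr.dAg) (Fin n → β × (α × β)))
    (preDephWithEnv ρ Pr)))

/-- `H(Y)` on the pre-dephasing state. -/
def preDephHY (ρ : Matrix (α × β) (α × β) ℂ) {n : ℕ} (Pr : Protocol α β n) : ℝ :=
  entropy (ptraceRight (Matrix.reindex
    (pullY (Fin Pr.dAp) (Fin Pr.dY) (Fin Pr.dAg) (Fin n → β))
    (pullY (Fin Pr.dAp) (Fin Pr.dY) (Fin Pr.dAg) (Fin n → β)) (stateAfterUA ρ Pr)))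

/-! ### Single-party purity concentration -/

/-- An `(n, ·, ·)` purity concentration protocol: a unitary
`U : H_{A^n} → H_{A_p} ⊗ H_{A_g}`. -/
structure ConcProtocol (α : Type*) [Fintype α] [DecidableEq α] (n : ℕ) where
  dAp : ℕ
  dAg : ℕ
  dAp_pos : 0 < dAp
  dAg_pos : 0 < dAg
  U : Matrix (Fin dAp × Fin dAg) (Fin n → α) ℂ
  U_unitary : Uᴴ * U = 1 ∧ U * Uᴴ = 1

/-- The reduced state `Υ^{A_p}` of `U ρ^{⊗n} U†`. -/
def concOutput {α : Type*} [Fintype α] [DecidableEq α] (ρ : Matrix α α ℂ) {n : ℕ}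
    (Pr : ConcProtocol α n) : Matrix (Fin Pr.dAp) (Fin Pr.dAp) ℂ :=
  ptraceRight (Pr.U * tpow ρ n * Pr.Uᴴ)

/-- Achievability of a purity-concentration rate `P`. -/
def ConcAchievable {α : Type*} [Fintype α] [DecidableEq α] (ρ : Matrix α α ℂ) (P : ℝ) :
    Prop :=
  ∀ ε > (0 : ℝ), ∀ δ > (0 : ℝ), ∃ N : ℕ, ∀ n ≥ N, ∃ Pr : ConcProtocol α n,
    P - δ ≤ Real.log Pr.dAp / n ∧ traceNorm (concOutput ρ Pr - pureZero Pr.dAp) ≤ ε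

/-- The purity `κ(ρ)`: the supremum of all achievable concentration rates. -/
def kappaConc {α : Type*} [Fintype α] [DecidableEq α] (ρ : Matrix α α ℂ) : ℝ :=
  sSup { P : ℝ | ConcAchievable ρ P }

/-! ### Measurement compression -/

/-- The averaged compressed-measurement map
`σ ↦ (1/|L|) Σ_l Σ_m Tr(Λ̃^{(l)}_m σ) |f(m,l)⟩⟨f(m,l)|`, applied to the first factor. -/
def mcMap {A Ω γ' : Type*} [Fintype A] [DecidableEq A] [Fintype Ω] [DecidableEq Ω]
    (L M : ℕ) (Λt : Fin L → POVM A (Fin M)) (f : Fin M → Fin L → Ω)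
    (ρ : Matrix (A × γ') (A × γ') ℂ) : Matrix (Ω × γ') (Ω × γ') ℂ :=
  fun p q => (L : ℂ)⁻¹ * ∑ l, ∑ m, (if f m l = p.1 ∧ f m l = q.1 then 1 else 0) *
    ∑ a, ∑ a', ((Λt l).elem m) a a' * ρ (a', p.2) (a, q.2)

/-! ### Classical-quantum states and classical channels -/

/-- The classical-quantum state `Σ_x p(x) |x⟩⟨x| ⊗ ρ_x`. -/
def cqState {𝒳 B : Type*} [DecidableEq 𝒳] (p : 𝒳 → ℝ) (ρx : 𝒳 → Matrix B B ℂ) :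
    Matrix (𝒳 × B) (𝒳 × B) ℂ :=
  fun P Q => if P.1 = Q.1 then (p P.1 : ℂ) * ρx P.1 P.2 Q.2 else 0

/-- The state on `Y × (X × W)` obtained from a purification vector `ψ` of a cq state
(with classical system `X` and the rest `W`) by applying a classical channel `q(y|x)`
to the classical system: `Σ_{x,y} q(y|x) |y⟩⟨y| ⊗ |x⟩⟨x|-block of p(x)·(BE state given x)`. -/
def chanState {𝒳 W 𝒴 : Type*} [DecidableEq 𝒳] [DecidableEq 𝒴]
    (ψ : 𝒳 × W → ℂ) (q : 𝒳 → 𝒴 → ℝ) :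
    Matrix (𝒴 × (𝒳 × W)) (𝒴 × (𝒳 × W)) ℂ :=
  fun P Q => if P.1 = Q.1 ∧ P.2.1 = Q.2.1
    then (q P.2.1 P.1 : ℂ) * ψ P.2 * star (ψ Q.2) else 0

/-- The `n`-fold tensor power of a purification vector of a cq state, with the
classical, `B` and `E` registers collected. -/
def vecPowBE {𝒳 B E : Type*} (ψ : 𝒳 × (B × E) → ℂ) (n : ℕ) :
    (Fin n → 𝒳) × ((Fin n → B) × (Fin n → E)) → ℂ :=
  fun xw => ∏ k, ψ (xw.1 k, (xw.2.1 k, xw.2.2 k))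

variable {𝒴' 𝒳 B E : Type*} [Fintype 𝒴'] [DecidableEq 𝒴'] [Fintype 𝒳] [DecidableEq 𝒳]
  [Fintype B] [DecidableEq B] [Fintype E] [DecidableEq E]

/-- `I(Y;B)` on a state of the form `τ^{Y(X(BE))}`. -/
def miYB (τ : Matrix (𝒴' × (𝒳 × (B × E))) (𝒴' × (𝒳 × (B × E))) ℂ) : ℝ :=
  mutualInfo (ptraceRight (Matrix.reindex (exYB 𝒴' 𝒳 B E) (exYB 𝒴' 𝒳 B E) τ))

/-- `I(Y;BE)` on a state of the form `τ^{Y(X(BE))}`. -/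
def miYBE (τ : Matrix (𝒴' × (𝒳 × (B × E))) (𝒴' × (𝒳 × (B × E))) ℂ) : ℝ :=
  mutualInfo (ptraceRight (Matrix.reindex (exYW 𝒴' 𝒳 (B × E)) (exYW 𝒴' 𝒳 (B × E)) τ))

/-- `I(Y;X)` on a state of the form `τ^{Y(X(BE))}`. -/
def miYX (τ : Matrix (𝒴' × (𝒳 × (B × E))) (𝒴' × (𝒳 × (B × E))) ℂ) : ℝ :=
  mutualInfo (ptraceRight (Matrix.reindex (exYX 𝒴' 𝒳 (B × E)) (exYX 𝒴' 𝒳 (B × E)) τ))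

/-- A classical channel: entrywise nonnegative with rows summing to one. -/
def IsChannel {X Y : Type*} [Fintype Y] (q : X → Y → ℝ) : Prop :=
  (∀ x y, 0 ≤ q x y) ∧ ∀ x, ∑ y, q x y = 1

/-- `P_n(R) = max_{Y|X^n} { (1/n) I(Y;B^n) : (1/n) I(Y;B^nE^n) ≤ R }` for a cq state
with purification vector `ψ`. -/
def Pn (ψ : 𝒳 × (B × E) → ℂ) (n : ℕ) (R : ℝ) : ℝ :=
  sSup { v : ℝ | ∃ (m : ℕ) (q : (Fin n → 𝒳) → Fin m → ℝ), IsChannel q ∧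
    (1 / n : ℝ) * miYBE (chanState (vecPowBE ψ n) q) ≤ R ∧
    v = (1 / n : ℝ) * miYB (chanState (vecPowBE ψ n) q) }

/-- `D_n(R) = max_{Y|X^n} { (1/n) I(Y;B^n) : (1/n)(I(Y;X^n) - I(Y;B^n)) ≤ R }` for a cq
state with purification vector `ψ`. -/
def Dn (ψ : 𝒳 × (B × E) → ℂ) (n : ℕ) (R : ℝ) : ℝ :=
  sSup { v : ℝ | ∃ (m : ℕ) (q : (Fin n → 𝒳) → Fin m → ℝ), IsChannel q ∧
    (1 / n : ℝ) * (miYX (chanState (vecPowBE ψ n) q)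
      - miYB (chanState (vecPowBE ψ n) q)) ≤ R ∧
    v = (1 / n : ℝ) * miYB (chanState (vecPowBE ψ n) q) }

/-! ### Quantum channels -/

/-- A completely positive trace-preserving map between matrix algebras. -/
structure CPTP (ι κ : Type*) [Fintype ι] [DecidableEq ι] [Fintype κ] [DecidableEq κ] where
  map : Matrix ι ι ℂ →ₗ[ℂ] Matrix κ κ ℂ
  trace_preserving : ∀ ρ, (map ρ).trace = ρ.trace
  completely_positive : ∀ (n : ℕ) (ρ : Matrix (ι × Fin n) (ι × Fin n) ℂ), ρ.PosSemidef →
    (Matrix.of fun p q : κ × Fin n =>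
      map (Matrix.of fun i i' => ρ (i, p.2) (i', q.2)) p.1 q.1).PosSemidef


lemma cpb_entropy_diag {ι : Type*} [Fintype ι] [DecidableEq ι] (ρ V : Matrix ι ι ℂ) (l : ι → ℝ)
    (hV : Vᴴ * V = 1) (h : ρ = V * diagonal (fun i => (l i : ℂ)) * Vᴴ) :
    entropy ρ = -∑ i, l i * Real.log (l i) := by
  have hH : ρ.IsHermitian := by
    rw [h, Matrix.IsHermitian, conjTranspose_mul, conjTranspose_mul, conjTranspose_conjTranspose,
      diagonal_conjTranspose, Matrix.mul_assoc]
    congr 3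
    ext i
    simp
  have h1 : ρ.charpoly = ∏ i, (Polynomial.X - Polynomial.C (l i : ℂ)) := by
    rw [h, charpoly_mul_comm, ← mul_assoc, hV, one_mul, charpoly_diagonal]
  have h2 := hH.roots_charpoly_eq_eigenvalues
  have h5 : (∏ i, (Polynomial.X - Polynomial.C (l i : ℂ))).roots
      = Multiset.map (fun i => (l i : ℂ)) Finset.univ.val := by
    rw [Polynomial.roots_prod]
    · simp
    · simp [Finset.prod_ne_zero_iff, Polynomial.X_sub_C_ne_zero]
  rw [h1, h5] at h2
  have h3 : Multiset.map l Finset.univ.val = Multiset.map hH.eigenvalues Finset.univ.val := by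
    apply Multiset.map_injective (f := (fun x : ℝ => (x : ℂ))) Complex.ofReal_injective
    simp only [Multiset.map_map]
    exact h2
  have h4 := congrArg (fun s => (Multiset.map (fun x => x * Real.log x) s).sum) h3
  simp only [Multiset.map_map] at h4
  unfold entropy
  rw [dif_pos hH]
  congr 1
  exact h4.symm

lemma cpb_exists_diag {ι : Type*} [Fintype ι] [DecidableEq ι] (ρ : Matrix ι ι ℂ)
    (h : ρ.PosSemidef) : ∃ (V : Matrix ι ι ℂ) (l : ι → ℝ), Vᴴ * V = 1 ∧ V * Vᴴ = 1 ∧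
      (∀ i, 0 ≤ l i) ∧ ρ = V * diagonal (fun i => (l i : ℂ)) * Vᴴ := by
  refine ⟨h.1.eigenvectorUnitary.1, h.1.eigenvalues, ?_, ?_, h.eigenvalues_nonneg, ?_⟩
  · exact Unitary.coe_star_mul_self h.1.eigenvectorUnitary
  · exact Unitary.coe_mul_star_self h.1.eigenvectorUnitary
  · exact h.1.spectral_theorem

lemma cpb_trace_re_nonneg {ι : Type*} [Fintype ι] {M : Matrix ι ι ℂ} (h : M.PosSemidef) :
    0 ≤ M.trace.re := by
  have := h.trace_nonneg
  exact (Complex.le_def.1 this).1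

lemma cpb_trace_iso {ι κ : Type*} [Fintype ι] [DecidableEq ι] [Fintype κ] [DecidableEq κ]
    (L : Matrix κ ι ℂ) (hL : Lᴴ * L = 1) (M : Matrix κ κ ℂ) (hM : M.PosSemidef) :
    (Lᴴ * M * L).trace.re ≤ M.trace.re := by
  set K : Matrix κ κ ℂ := 1 - L * Lᴴ with hK
  have hKh : Kᴴ = K := by
    simp [hK]
  have hKK : K * K = K := by
    have : L * Lᴴ * (L * Lᴴ) = L * Lᴴ := by
      rw [Matrix.mul_assoc, ← Matrix.mul_assoc Lᴴ, hL, Matrix.one_mul]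
    rw [hK, Matrix.sub_mul, Matrix.mul_sub, Matrix.mul_sub, this]
    simp
  have h1 := cpb_trace_re_nonneg (hM.mul_mul_conjTranspose_same K)
  have h2 : (K * M * Kᴴ).trace = M.trace - (Lᴴ * M * L).trace := by
    rw [hKh, trace_mul_comm, ← Matrix.mul_assoc, hKK, hK, Matrix.sub_mul, trace_sub, Matrix.one_mul,
      Matrix.mul_assoc, trace_mul_comm L]
  rw [h2, Complex.sub_re] at h1
  linarith

lemma cpb_tr_mul {ι κ : Type*} [Fintype ι] [Fintype κ] (A : Matrix ι κ ℂ) (B : Matrix κ ι ℂ) :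
    (A * B).trace.re = ∑ i, ∑ j, (A i j * B j i).re := by
  simp only [trace, Matrix.diag, Matrix.mul_apply, Complex.re_sum]

/-- the resolvent inequality -/
lemma cpb_resolvent {ι κ : Type*} [Fintype ι] [DecidableEq ι] [Fintype κ] [DecidableEq κ]
    (L : Matrix κ ι ℂ) (hL : Lᴴ * L = 1) (V W : Matrix ι ι ℂ)
    (hV : V * Vᴴ = 1) (hW : W * Wᴴ = 1) (l m : ι → ℝ) (hl : ∀ i, 0 ≤ l i) (hm : ∀ i, 0 < m i)
    (P Q : κ → ℝ)
    (hP : ∀ k, P k = ((L * (V * diagonal (fun i => (l i : ℂ)) * Vᴴ) * Lᴴ) k k).re)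
    (hQ : ∀ k, Q k = ((L * (W * diagonal (fun i => (m i : ℂ)) * Wᴴ) * Lᴴ) k k).re)
    (t : ℝ) (ht : 0 ≤ t) (z : κ → ℝ) :
    ∑ k, (2 * z k * P k - z k ^ 2 * (Q k + t * P k)) ≤
      ∑ i, ∑ j, Complex.normSq ((Vᴴ * W) i j) * (l i ^ 2 / (m j + t * l i)) := by
  set D : Matrix κ κ ℂ := diagonal (fun k => (z k : ℂ)) with hD
  set Λ : Matrix ι ι ℂ := diagonal (fun i => (l i : ℂ)) with hΛ
  set M : Matrix ι ι ℂ := diagonal (fun i => (m i : ℂ)) with hM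
  set Z : Matrix ι ι ℂ := Lᴴ * D * L with hZ
  set b : Matrix ι ι ℂ := Vᴴ * Z * W with hb
  set O : Matrix ι ι ℂ := Vᴴ * W with hO
  have hDh : Dᴴ = D := by
    rw [hD, diagonal_conjTranspose]; congr 1; ext i; simp
  have hZh : Zᴴ = Z := by
    simp only [hZ, conjTranspose_mul, conjTranspose_conjTranspose, hDh, Matrix.mul_assoc]
  have hΛp : Λ.PosSemidef := by
    rw [hΛ]; apply PosSemidef.diagonal; intro i; simpa using hl i
  have hMp : M.PosSemidef := by
    rw [hM]; apply PosSemidef.diagonal; intro i; simpa using (hm i).le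
  have e1 : ∑ i, ∑ j, l i * (star (O i j) * b i j).re = ∑ k, z k * P k := by
    have a1 : ∑ i, ∑ j, l i * (star (O i j) * b i j).re = (Λ * (b * Oᴴ)).trace.re := by
      rw [← Matrix.mul_assoc, cpb_tr_mul]
      simp only [hΛ, diagonal_mul, conjTranspose_apply]
      refine Finset.sum_congr rfl fun i _ => Finset.sum_congr rfl fun j _ => ?_
      rw [mul_assoc, Complex.re_ofReal_mul, mul_comm (b i j)]
    have a2 : (Λ * (b * Oᴴ)).trace = (D * (L * (V * Λ * Vᴴ) * Lᴴ)).trace := by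
      have : b * Oᴴ = Vᴴ * Z * V := by
        rw [hb, hO, conjTranspose_mul, conjTranspose_conjTranspose, Matrix.mul_assoc,
          ← Matrix.mul_assoc W, hW, Matrix.one_mul]
      rw [this, hZ, trace_mul_comm Λ]
      simp only [Matrix.mul_assoc]
      rw [trace_mul_comm Vᴴ, Matrix.mul_assoc, trace_mul_comm Lᴴ]
      simp only [Matrix.mul_assoc]
    rw [a1, a2]
    simp only [trace, Matrix.diag, hD, diagonal_mul, Complex.re_sum]
    refine Finset.sum_congr rfl fun k _ => ?_
    rw [Complex.re_ofReal_mul, hP]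
  have e2 : ∑ i, ∑ j, m j * Complex.normSq (b i j) ≤ ∑ k, z k ^ 2 * Q k := by
    have a1 : ∑ i, ∑ j, m j * Complex.normSq (b i j) = (b * M * bᴴ).trace.re := by
      rw [cpb_tr_mul]
      simp only [hM, mul_diagonal, conjTranspose_apply]
      refine Finset.sum_congr rfl fun i _ => Finset.sum_congr rfl fun j _ => ?_
      rw [mul_comm (b i j), mul_assoc, Complex.re_ofReal_mul]
      congr 1
      simp [Complex.mul_conj, Complex.normSq_apply]
    have a2 : (b * M * bᴴ).trace = (Lᴴ * (D * L * (W * M * Wᴴ) * (D * L)ᴴ) * L).trace := by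
      have : b * M * bᴴ = Vᴴ * (Z * (W * M * Wᴴ) * Z * V) := by
        rw [hb]
        simp only [conjTranspose_mul, conjTranspose_conjTranspose, hZh, Matrix.mul_assoc]
      rw [this, trace_mul_comm, Matrix.mul_assoc, hV, Matrix.mul_one, hZ]
      simp only [Matrix.mul_assoc, conjTranspose_mul, hDh]
    rw [a1, a2]
    refine (cpb_trace_iso L hL _ ((hMp.mul_mul_conjTranspose_same W).mul_mul_conjTranspose_same _)).trans
      (le_of_eq ?_)
    have : D * L * (W * M * Wᴴ) * (D * L)ᴴ = D * (L * (W * M * Wᴴ) * Lᴴ) * D := by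
      simp only [Matrix.mul_assoc, conjTranspose_mul, hDh]
    rw [this]
    simp only [trace, Matrix.diag, hD, diagonal_mul, mul_diagonal, Complex.re_sum]
    refine Finset.sum_congr rfl fun k _ => ?_
    rw [mul_assoc, mul_comm _ ((z k : ℂ)), Complex.re_ofReal_mul, Complex.re_ofReal_mul, hQ]
    ring
  have e3 : ∑ i, ∑ j, l i * Complex.normSq (b i j) ≤ ∑ k, z k ^ 2 * P k := by
    have a1 : ∑ i, ∑ j, l i * Complex.normSq (b i j) = (bᴴ * Λ * b).trace.re := by
      rw [Finset.sum_comm]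
      rw [cpb_tr_mul]
      simp only [hΛ, mul_diagonal, conjTranspose_apply]
      refine Finset.sum_congr rfl fun i _ => Finset.sum_congr rfl fun j _ => ?_
      rw [mul_comm (star _), mul_assoc, Complex.re_ofReal_mul]
      congr 1
      simp [Complex.normSq_apply]
    have a2 : (bᴴ * Λ * b).trace = (Lᴴ * (D * L * (V * Λ * Vᴴ) * (D * L)ᴴ) * L).trace := by
      have : bᴴ * Λ * b = Wᴴ * (Z * (V * Λ * Vᴴ) * Z * W) := by
        rw [hb]
        simp only [conjTranspose_mul, conjTranspose_conjTranspose, hZh, Matrix.mul_assoc]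
      rw [this, trace_mul_comm, Matrix.mul_assoc, hW, Matrix.mul_one, hZ]
      simp only [Matrix.mul_assoc, conjTranspose_mul, hDh]
    rw [a1, a2]
    refine (cpb_trace_iso L hL _ ((hΛp.mul_mul_conjTranspose_same V).mul_mul_conjTranspose_same _)).trans
      (le_of_eq ?_)
    have : D * L * (V * Λ * Vᴴ) * (D * L)ᴴ = D * (L * (V * Λ * Vᴴ) * Lᴴ) * D := by
      simp only [Matrix.mul_assoc, conjTranspose_mul, hDh]
    rw [this]
    simp only [trace, Matrix.diag, hD, diagonal_mul, mul_diagonal, Complex.re_sum]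
    refine Finset.sum_congr rfl fun k _ => ?_
    rw [mul_assoc, mul_comm _ ((z k : ℂ)), Complex.re_ofReal_mul, Complex.re_ofReal_mul, hP]
    ring
  have key : ∀ i j, 2 * (l i * (star (O i j) * b i j).re)
      - (m j * Complex.normSq (b i j) + t * (l i * Complex.normSq (b i j))) ≤
      Complex.normSq (O i j) * (l i ^ 2 / (m j + t * l i)) := by
    intro i j
    have hc : 0 < m j + t * l i := by have := hm j; have := mul_nonneg ht (hl i); linarith
    rw [← mul_div_assoc, le_div_iff₀ hc]
    simp only [Complex.normSq_apply, Complex.star_def, Complex.mul_re, Complex.conj_re,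
      Complex.conj_im]
    nlinarith [sq_nonneg (l i * (O i j).re - (m j + t * l i) * (b i j).re),
      sq_nonneg (l i * (O i j).im - (m j + t * l i) * (b i j).im)]
  have := Finset.sum_le_sum fun i (_ : i ∈ Finset.univ) =>
    Finset.sum_le_sum fun j (_ : j ∈ Finset.univ) => key i j
  refine le_trans ?_ this
  simp only [Finset.sum_sub_distrib, Finset.sum_add_distrib, ← Finset.mul_sum, mul_assoc, mul_add]
  have e4 : ∑ k, z k ^ 2 * (t * P k) = t * ∑ k, z k ^ 2 * P k := by
    rw [Finset.mul_sum]; exact Finset.sum_congr rfl fun k _ => by ring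
  have e1' := e1
  have e3' := mul_le_mul_of_nonneg_left e3 ht
  simp only [← Finset.mul_sum] at e1 e3' ⊢
  rw [e4, e1]
  linarith



lemma cpb_log_split (q p T : ℝ) (hq : 0 ≤ q) (hp : 0 ≤ p) (hT : 0 < T) :
    p * Real.log (q + T * p) = p * Real.log T + p * Real.log (q / T + p) := by
  rcases hp.eq_or_lt with h | h
  · simp [← h]
  · have h1 : 0 < q / T + p := by positivity
    have : q + T * p = T * (q / T + p) := by field_simp
    rw [this, Real.log_mul hT.ne' h1.ne']; ring

lemma cpb_log_tendsto (q p : ℝ) :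
    Tendsto (fun T : ℝ => p * Real.log (q / T + p)) atTop (nhds (p * Real.log p)) := by
  rcases eq_or_ne p 0 with h | h
  · simp [h]
  · have h1 : Tendsto (fun T : ℝ => q / T + p) atTop (nhds (0 + p)) :=
      (tendsto_const_nhds.div_atTop tendsto_id).add tendsto_const_nhds
    rw [zero_add] at h1
    exact (h1.log h).const_mul p

lemma cpb_analytic {I K : Type*} [Fintype I] [Fintype K] (w l m : I → ℝ) (P Q : K → ℝ)
    (hl : ∀ i, 0 ≤ l i) (hm : ∀ i, 0 < m i) (hP : ∀ k, 0 ≤ P k)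
    (hQ : ∀ k, 0 ≤ Q k) (hPQ : ∀ k, Q k = 0 → P k = 0) (hs : ∑ i, w i * l i = ∑ k, P k)
    (h : ∀ t : ℝ, 0 ≤ t → ∑ k, P k * (P k / (Q k + t * P k)) ≤
      ∑ i, w i * (l i * (l i / (m i + t * l i)))) :
    ∑ i, w i * (l i * Real.log (m i)) - ∑ k, P k * Real.log (Q k) ≤
      ∑ i, w i * (l i * Real.log (l i)) - ∑ k, P k * Real.log (P k) := by
  set G : ℝ → ℝ := fun t => ∑ i, w i * (l i * Real.log (m i + t * l i))
    - ∑ k, P k * Real.log (Q k + t * P k) with hG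
  have hder : ∀ t : ℝ, 0 ≤ t → HasDerivAt G (∑ i, w i * (l i * (l i / (m i + t * l i)))
      - ∑ k, P k * (P k / (Q k + t * P k))) t := by
    intro t ht
    apply HasDerivAt.sub
    · apply HasDerivAt.fun_sum
      intro i _
      have h0 : m i + t * l i ≠ 0 := by
        have := hm i; have := mul_nonneg ht (hl i); linarith
      have h1 : HasDerivAt (fun t : ℝ => m i + t * l i) (l i) t := by
        simpa using ((hasDerivAt_id t).mul_const (l i)).const_add (m i)
      exact ((h1.log h0).const_mul _).const_mul _
    · apply HasDerivAt.fun_sum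
      intro k _
      rcases eq_or_ne (Q k) 0 with hq | hq
      · simp only [hPQ k hq, zero_mul]
        exact hasDerivAt_const _ _
      have h0 : Q k + t * P k ≠ 0 := by
        have := lt_of_le_of_ne (hQ k) hq.symm; have := mul_nonneg ht (hP k); linarith
      have h1 : HasDerivAt (fun t : ℝ => Q k + t * P k) (P k) t := by
        simpa using ((hasDerivAt_id t).mul_const (P k)).const_add (Q k)
      exact (h1.log h0).const_mul _
  have hmono : MonotoneOn G (Set.Ici 0) := by
    apply monotoneOn_of_deriv_nonneg (convex_Ici 0)
    · intro t ht; exact (hder t ht).continuousAt.continuousWithinAt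
    · intro t ht; exact (hder t (interior_subset ht)).differentiableAt.differentiableWithinAt
    · intro t ht
      rw [(hder t (interior_subset ht)).deriv]
      have := h t (interior_subset ht)
      linarith
  have hlim : Tendsto G atTop (nhds (∑ i, w i * (l i * Real.log (l i))
      - ∑ k, P k * Real.log (P k))) := by
    have h1 : Tendsto (fun T : ℝ => ∑ i, w i * (l i * Real.log (m i / T + l i))
        - ∑ k, P k * Real.log (Q k / T + P k)) atTop (nhds (∑ i, w i * (l i * Real.log (l i))
      - ∑ k, P k * Real.log (P k))) := by
      apply Tendsto.sub
      · exact tendsto_finsetSum _ fun i _ => (cpb_log_tendsto _ _).const_mul _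
      · exact tendsto_finsetSum _ fun i _ => cpb_log_tendsto _ _
    refine h1.congr' ?_
    filter_upwards [eventually_gt_atTop (0:ℝ)] with T hT
    simp only [hG]
    simp only [fun i => cpb_log_split (m i) (l i) T (hm i).le (hl i) hT,
      fun i => cpb_log_split (Q i) (P i) T (hQ i) (hP i) hT, mul_add, Finset.sum_add_distrib]
    have e1 : ∑ i, w i * (l i * Real.log T) = (∑ i, w i * l i) * Real.log T := by
      rw [Finset.sum_mul]; exact Finset.sum_congr rfl fun i _ => by ring
    have e2 : ∑ k, P k * Real.log T = (∑ i, P i) * Real.log T := by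
      rw [Finset.sum_mul]
    rw [e1, e2, hs]; ring
  have h0 : G 0 = ∑ i, w i * (l i * Real.log (m i)) - ∑ k, P k * Real.log (Q k) := by
    simp [hG]
  rw [← h0]
  refine ge_of_tendsto hlim ?_
  filter_upwards [eventually_ge_atTop (0:ℝ)] with T hT
  exact hmono (by simp) (by simpa using hT) hT

lemma cpb_diag_entry {ι κ : Type*} [Fintype ι] [DecidableEq ι] [Fintype κ]
    (L : Matrix κ ι ℂ) (V : Matrix ι ι ℂ) (l : ι → ℝ) (k : κ) :
    ((L * (V * diagonal (fun i => (l i : ℂ)) * Vᴴ) * Lᴴ) k k).re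
      = ∑ i, l i * Complex.normSq ((L * V) k i) := by
  have : L * (V * diagonal (fun i => (l i : ℂ)) * Vᴴ) * Lᴴ
      = (L * V) * diagonal (fun i => (l i : ℂ)) * (L * V)ᴴ := by
    simp only [conjTranspose_mul, Matrix.mul_assoc]
  rw [this]
  generalize L * V = X
  rw [Matrix.mul_apply, Complex.re_sum]
  refine Finset.sum_congr rfl fun i _ => ?_
  simp only [mul_diagonal, conjTranspose_apply]
  rw [mul_comm (X k i), mul_assoc, Complex.re_ofReal_mul]
  simp [Complex.normSq_apply]

lemma cpb_dpi {ι κ : Type*} [Fintype ι] [DecidableEq ι] [Fintype κ] [DecidableEq κ]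
    (L : Matrix κ ι ℂ) (hL : Lᴴ * L = 1) (V W : Matrix ι ι ℂ)
    (hV : V * Vᴴ = 1) (hV2 : Vᴴ * V = 1) (hW : W * Wᴴ = 1) (l m : ι → ℝ)
    (hl : ∀ i, 0 ≤ l i) (hm : ∀ i, 0 < m i) (P Q : κ → ℝ)
    (hP : ∀ k, P k = ((L * (V * diagonal (fun i => (l i : ℂ)) * Vᴴ) * Lᴴ) k k).re)
    (hQ : ∀ k, Q k = ((L * (W * diagonal (fun i => (m i : ℂ)) * Wᴴ) * Lᴴ) k k).re) :
    -∑ i, l i * Real.log (l i) ≤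
      - ∑ j, Real.log (m j) *
        ((Wᴴ * (V * diagonal (fun i => (l i : ℂ)) * Vᴴ) * W) j j).re
      + ∑ k, P k * (Real.log (Q k) - Real.log (P k)) := by
  have hP' : ∀ k, P k = ∑ i, l i * Complex.normSq ((L * V) k i) := fun k => by
    rw [hP, cpb_diag_entry]
  have hQ' : ∀ k, Q k = ∑ i, m i * Complex.normSq ((L * W) k i) := fun k => by
    rw [hQ, cpb_diag_entry]
  have hP0 : ∀ k, 0 ≤ P k := fun k => by
    rw [hP']; exact Finset.sum_nonneg fun i _ => mul_nonneg (hl i) (Complex.normSq_nonneg _)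
  have hQ0 : ∀ k, 0 ≤ Q k := fun k => by
    rw [hQ']; exact Finset.sum_nonneg fun i _ => mul_nonneg (hm i).le (Complex.normSq_nonneg _)
  have hPQ : ∀ k, Q k = 0 → P k = 0 := by
    intro k h
    rw [hQ', Finset.sum_eq_zero_iff_of_nonneg
      (fun i _ => mul_nonneg (hm i).le (Complex.normSq_nonneg _))] at h
    have h1 : ∀ i, (L * W) k i = 0 := fun i => by
      have := h i (Finset.mem_univ _)
      rcases mul_eq_zero.1 this with h' | h'
      · exact absurd h' (hm i).ne'
      · exact Complex.normSq_eq_zero.1 h'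
    have h2 : L * V = (L * W) * (Wᴴ * V) := by
      rw [Matrix.mul_assoc, ← Matrix.mul_assoc W, hW, Matrix.one_mul]
    rw [hP']
    apply Finset.sum_eq_zero
    intro i _
    rw [h2, Matrix.mul_apply]
    simp [h1]
  set w : ι → ι → ℝ := fun i j => Complex.normSq ((Vᴴ * W) i j) with hw
  have hw1 : ∀ i, ∑ j, w i j = 1 := by
    intro i
    have h1 : (Vᴴ * W) * (Vᴴ * W)ᴴ = 1 := by
      rw [conjTranspose_mul, conjTranspose_conjTranspose, Matrix.mul_assoc, ← Matrix.mul_assoc W,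
        hW, Matrix.one_mul, hV2]
    have h2 := congrFun (congrFun h1 i) i
    rw [Matrix.mul_apply] at h2
    have h3 := congrArg Complex.re h2
    simp only [conjTranspose_apply, Matrix.one_apply_eq, Complex.one_re, Complex.re_sum] at h3
    rw [← h3]
    refine Finset.sum_congr rfl fun j _ => ?_
    simp [hw, Complex.normSq_apply]
  have hsumP : ∑ k, P k = ∑ i, l i := by
    have h1 : (L * (V * diagonal (fun i => (l i : ℂ)) * Vᴴ) * Lᴴ).trace
        = (diagonal (fun i => (l i : ℂ)) : Matrix ι ι ℂ).trace := by
      rw [trace_mul_comm, ← Matrix.mul_assoc, hL, Matrix.one_mul, trace_mul_comm,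
        ← Matrix.mul_assoc, hV2, Matrix.one_mul]
    have h2 := congrArg Complex.re h1
    rw [trace_diagonal] at h2
    simp only [trace, Matrix.diag, Complex.re_sum, Complex.ofReal_re] at h2
    rw [← h2]
    exact Finset.sum_congr rfl fun k _ => hP k
  have hmid : ∀ j, ((Wᴴ * (V * diagonal (fun i => (l i : ℂ)) * Vᴴ) * W) j j).re
      = ∑ i, l i * w i j := by
    intro j
    have := cpb_diag_entry Wᴴ V l j
    rw [conjTranspose_conjTranspose] at this
    rw [this]
    refine Finset.sum_congr rfl fun i _ => ?_
    have : Wᴴ * V = (Vᴴ * W)ᴴ := by rw [conjTranspose_mul, conjTranspose_conjTranspose]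
    rw [this, conjTranspose_apply]
    simp [hw, Complex.normSq_conj]
  have main := cpb_analytic (I := ι × ι) (fun x => w x.1 x.2) (fun x => l x.1) (fun x => m x.2)
    P Q (fun x => hl x.1) (fun x => hm x.2) hP0 hQ0 hPQ ?_ ?_
  · simp only [Fintype.sum_prod_type] at main
    have e1 : ∑ i, ∑ j, w i j * (l i * Real.log (l i)) = ∑ i, l i * Real.log (l i) := by
      simp only [← Finset.sum_mul, hw1, one_mul]
    have e2 : ∑ i, ∑ j, w i j * (l i * Real.log (m j)) = ∑ j, Real.log (m j) *
        ((Wᴴ * (V * diagonal (fun i => (l i : ℂ)) * Vᴴ) * W) j j).re := by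
      rw [Finset.sum_comm]
      refine Finset.sum_congr rfl fun j _ => ?_
      rw [hmid, Finset.mul_sum]
      exact Finset.sum_congr rfl fun i _ => by ring
    rw [e1, e2] at main
    simp only [mul_sub, Finset.sum_sub_distrib]
    linarith
  · simp only [Fintype.sum_prod_type, ← Finset.sum_mul, hw1, one_mul]
    exact hsumP.symm
  · intro t ht
    have := cpb_resolvent L hL V W hV hW l m hl hm P Q hP hQ t ht
      (fun k => P k / (Q k + t * P k))
    simp only [Fintype.sum_prod_type]
    refine le_trans (le_of_eq ?_) (this.trans (le_of_eq ?_))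
    · refine Finset.sum_congr rfl fun k _ => ?_
      rcases eq_or_ne (Q k) 0 with hq | hq
      · simp [hPQ k hq]
      have h0 : Q k + t * P k ≠ 0 := by
        have := lt_of_le_of_ne (hQ0 k) hq.symm; have := mul_nonneg ht (hP0 k); linarith
      field_simp
      ring
    · refine Finset.sum_congr rfl fun i _ => Finset.sum_congr rfl fun j _ => ?_
      simp only [hw]
      ring



lemma cpb_aside {ι κ : Type*} [Fintype ι] [DecidableEq ι] [Fintype κ] [DecidableEq κ]
    (J : Matrix κ ι ℂ) (hJ : Jᴴ * J = 1) (ρ : Matrix ι ι ℂ) (hρ : ρ.PosSemidef) :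
    entropy ρ ≤ ∑ k, ((J * ρ * Jᴴ) k k).re *
      (Real.log ((J * Jᴴ) k k).re - Real.log ((J * ρ * Jᴴ) k k).re) := by
  obtain ⟨V, l, hV2, hV, hl, h⟩ := cpb_exists_diag ρ hρ
  rw [cpb_entropy_diag ρ V l hV2 h]
  have := cpb_dpi J hJ V 1 hV hV2 (by simp) l (fun _ => 1) hl (fun _ => one_pos)
    (fun k => ((J * ρ * Jᴴ) k k).re) (fun k => ((J * Jᴴ) k k).re) (fun k => by rw [← h])
    (fun k => by simp)
  simpa using this

/-- block-diagonal extension of a unitary -/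
def cpb_L {γ κ μ : Type*} [DecidableEq γ] (U : Matrix κ (μ × γ) ℂ) :
    Matrix (γ × κ) (γ × μ) ℂ :=
  fun x z => if x.1 = z.1 then U x.2 (z.2, x.1) else 0

lemma cpb_L_iso {γ κ μ : Type*} [Fintype γ] [DecidableEq γ] [Fintype κ] [Fintype μ]
    [DecidableEq μ] (U : Matrix κ (μ × γ) ℂ) (hU : Uᴴ * U = 1) :
    (cpb_L U)ᴴ * cpb_L U = 1 := by
  ext ⟨y, b⟩ ⟨y', b'⟩
  rw [Matrix.mul_apply, Fintype.sum_prod_type]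
  simp only [conjTranspose_apply, cpb_L]
  have h := congrFun (congrFun hU (b, y)) (b', y)
  rw [Matrix.mul_apply] at h
  simp only [conjTranspose_apply] at h
  by_cases hy : y = y'
  · subst hy
    rw [Finset.sum_eq_single y]
    · simp only [if_true]
      rw [h]
      simp [Matrix.one_apply]
    · intro x _ hx
      simp [hx]
    · simp
  · rw [Finset.sum_eq_zero]
    · simp [hy]
    · intro x _
      apply Finset.sum_eq_zero
      intro k _
      by_cases h1 : x = y
      · subst h1; simp [hy]
      · simp [h1]

lemma cpb_L_apply {γ κ μ : Type*} [Fintype γ] [DecidableEq γ] [Fintype κ] [Fintype μ]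
    [DecidableEq μ] (U : Matrix κ (μ × γ) ℂ) (τ : Matrix (γ × μ) (γ × μ) ℂ) (y : γ) (k : κ) :
    (cpb_L U * τ * (cpb_L U)ᴴ) (y, k) (y, k)
      = ∑ b, ∑ b', U k (b, y) * τ (y, b) (y, b') * star (U k (b', y)) := by
  rw [Matrix.mul_apply, Fintype.sum_prod_type, Finset.sum_eq_single y]
  · rw [Finset.sum_comm]
    refine Finset.sum_congr rfl fun b' _ => ?_
    rw [Matrix.mul_apply, Fintype.sum_prod_type, Finset.sum_eq_single y]
    · simp [cpb_L, Finset.sum_mul]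
    · intro x _ hx
      simp [cpb_L, hx.symm]
    · simp
  · intro x _ hx
    simp [cpb_L, hx.symm]
  · simp

lemma cpb_L_sum {γ κ μ : Type*} [Fintype γ] [DecidableEq γ] [Fintype κ] [Fintype μ]
    [DecidableEq μ] (U : Matrix κ (μ × γ) ℂ) (hU : Uᴴ * U = 1)
    (τ : Matrix (γ × μ) (γ × μ) ℂ) (y : γ) :
    ∑ k, (cpb_L U * τ * (cpb_L U)ᴴ) (y, k) (y, k) = ptraceRight τ y y := by
  simp only [cpb_L_apply]
  rw [Finset.sum_comm]
  unfold ptraceRight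
  refine Finset.sum_congr rfl fun b _ => ?_
  rw [Finset.sum_comm]
  have h : ∀ b', ∑ k, U k (b, y) * τ (y, b) (y, b') * star (U k (b', y))
      = if b = b' then τ (y, b) (y, b') else 0 := by
    intro b'
    have h := congrFun (congrFun hU (b', y)) (b, y)
    rw [Matrix.mul_apply] at h
    simp only [conjTranspose_apply] at h
    have : ∑ k, U k (b, y) * τ (y, b) (y, b') * star (U k (b', y))
      = τ (y, b) (y, b') * ∑ k, star (U k (b', y)) * U k (b, y) := by
      rw [Finset.mul_sum]; exact Finset.sum_congr rfl fun k _ => by ring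
    rw [this, h, Matrix.one_apply]
    simp [eq_comm]
  simp only [h, Finset.sum_ite_eq, Finset.mem_univ, if_true]

lemma cpb_ptraceRight_kron {γ μ : Type*} [Fintype γ] [DecidableEq γ] [Fintype μ]
    [DecidableEq μ] (τ : Matrix (γ × μ) (γ × μ) ℂ) (V : Matrix γ γ ℂ) :
    ptraceRight ((V ⊗ₖ (1 : Matrix μ μ ℂ))ᴴ * τ * (V ⊗ₖ (1 : Matrix μ μ ℂ)))
      = Vᴴ * ptraceRight τ * V := by
  ext i j
  simp only [ptraceRight, Matrix.mul_apply, Fintype.sum_prod_type, conjTranspose_apply,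
    kroneckerMap_apply, Matrix.one_apply]
  simp only [mul_ite, mul_one, mul_zero, Finset.sum_ite_eq', Finset.mem_univ, if_true,
    apply_ite star, star_zero, ite_mul, zero_mul]
  rw [Finset.sum_comm]
  refine Finset.sum_congr rfl fun x _ => ?_
  simp only [Finset.sum_mul, Finset.mul_sum]
  rw [Finset.sum_comm]

lemma cpb_ptraceRight_psd {γ μ : Type*} [Fintype γ] [DecidableEq γ] [Fintype μ]
    [DecidableEq μ] (τ : Matrix (γ × μ) (γ × μ) ℂ) (h : τ.PosSemidef) :
    (ptraceRight τ).PosSemidef := by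
  have : ptraceRight τ = ∑ b, τ.submatrix (fun a => (a, b)) (fun a => (a, b)) := by
    ext i j
    rw [Matrix.sum_apply]
    rfl
  rw [this]
  exact Matrix.posSemidef_sum _ fun b _ => h.submatrix _

lemma cpb_diag_re_nonneg {ι : Type*} [Fintype ι] {M : Matrix ι ι ℂ} (h : M.PosSemidef) (i : ι) :
    0 ≤ (M i i).re := (Complex.le_def.1 (h.diag_nonneg (i := i))).1

lemma cpb_bside {γ κ μ : Type*} [Fintype γ] [DecidableEq γ] [Fintype κ] [DecidableEq κ]
    [Fintype μ] [DecidableEq μ] (U : Matrix κ (μ × γ) ℂ) (hU : Uᴴ * U = 1)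
    (τ : Matrix (γ × μ) (γ × μ) ℂ) (hτ : τ.PosSemidef) :
    entropy τ - entropy (ptraceRight τ) ≤ ∑ x : γ × κ,
      ((cpb_L U * τ * (cpb_L U)ᴴ) x x).re *
      (Real.log ((ptraceRight τ x.1 x.1).re * ∑ b, Complex.normSq (U x.2 (b, x.1)))
        - Real.log ((cpb_L U * τ * (cpb_L U)ᴴ) x x).re) := by
  obtain ⟨V, l, hV2, hV, hl, h⟩ := cpb_exists_diag τ hτ
  obtain ⟨X, nu, hX2, hX, hnu, hr⟩ := cpb_exists_diag _ (cpb_ptraceRight_psd τ hτ)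
  set PB : γ × κ → ℝ := fun x => ((cpb_L U * τ * (cpb_L U)ᴴ) x x).re with hPB
  set t : γ × κ → ℝ := fun x => ∑ b, Complex.normSq (U x.2 (b, x.1)) with ht
  set p : γ → ℝ := fun y => (ptraceRight τ y y).re with hp
  have hPB0 : ∀ x, 0 ≤ PB x := fun x => cpb_diag_re_nonneg (hτ.mul_mul_conjTranspose_same _) x
  have hPBs : ∀ y, ∑ k, PB (y, k) = p y := fun y => by
    simp only [hPB, hp, ← cpb_L_sum U hU τ y, Complex.re_sum]
  set W : Matrix (γ × μ) (γ × μ) ℂ := X ⊗ₖ (1 : Matrix μ μ ℂ) with hW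
  have hWW : W * Wᴴ = 1 := by
    rw [hW, conjTranspose_kronecker, conjTranspose_one, ← mul_kronecker_mul, hX, Matrix.one_mul,
      one_kronecker_one]
  have step : ∀ η : ℝ, 0 < η → entropy τ - entropy (ptraceRight τ) ≤
      ∑ x, PB x * (Real.log ((p x.1 + η) * t x) - Real.log (PB x)) := by
    intro η hη
    have hsig : W * diagonal (fun z : γ × μ => ((nu z.1 + η : ℝ) : ℂ)) * Wᴴ
        = (ptraceRight τ + (η : ℂ) • (1 : Matrix γ γ ℂ)) ⊗ₖ (1 : Matrix μ μ ℂ) := by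
      have e1 : (diagonal (fun z : γ × μ => ((nu z.1 + η : ℝ) : ℂ)))
          = (diagonal (fun z : γ => ((nu z + η : ℝ) : ℂ))) ⊗ₖ (1 : Matrix μ μ ℂ) := by
        rw [← Matrix.diagonal_one, diagonal_kronecker_diagonal]
        simp
      have e2 : (diagonal (fun z : γ => ((nu z + η : ℝ) : ℂ)))
          = diagonal (fun z : γ => ((nu z : ℝ) : ℂ)) + (η : ℂ) • (1 : Matrix γ γ ℂ) := by
        rw [← Matrix.diagonal_one, ← diagonal_smul, diagonal_add]
        congr 1; ext i; simp
      rw [e1, hW, conjTranspose_kronecker, conjTranspose_one, ← mul_kronecker_mul,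
        ← mul_kronecker_mul, Matrix.one_mul, Matrix.one_mul, e2, Matrix.mul_add, Matrix.add_mul,
        ← hr, Matrix.mul_smul, Matrix.smul_mul, Matrix.mul_one, hX]
    have main := cpb_dpi (cpb_L U) (cpb_L_iso U hU) V W hV hV2 hWW l
      (fun z => nu z.1 + η) hl (fun z => by have := hnu z.1; linarith) PB
      (fun x => (p x.1 + η) * t x) (fun k => by rw [← h]) ?_
    · rw [← h, ← cpb_entropy_diag τ V l hV2 h] at main
      have e3 : ∑ j : γ × μ, Real.log (nu j.1 + η) * ((Wᴴ * τ * W) j j).re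
          = ∑ j, Real.log (nu j + η) * nu j := by
        rw [Fintype.sum_prod_type]
        refine Finset.sum_congr rfl fun j _ => ?_
        simp only []
        rw [← Finset.mul_sum]
        congr 1
        have e4 := congrFun (congrFun (cpb_ptraceRight_kron τ X) j) j
        have e5 : Xᴴ * ptraceRight τ * X = diagonal (fun i => (nu i : ℂ)) := by
          rw [hr, ← Matrix.mul_assoc, ← Matrix.mul_assoc, hX2, Matrix.one_mul, Matrix.mul_assoc,
            hX2, Matrix.mul_one]
        rw [e5, diagonal_apply_eq] at e4
        have e6 := congrArg Complex.re e4
        rw [Complex.ofReal_re] at e6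
        rw [← e6, ptraceRight, Complex.re_sum]
      rw [e3] at main
      have e7 : entropy (ptraceRight τ) = -∑ i, nu i * Real.log (nu i) :=
        cpb_entropy_diag _ X nu hX2 hr
      have e8 : ∑ i, nu i * Real.log (nu i) ≤ ∑ j, Real.log (nu j + η) * nu j := by
        refine Finset.sum_le_sum fun j _ => ?_
        rcases (hnu j).eq_or_lt with h0 | h0
        · simp [← h0]
        · rw [mul_comm]
          exact mul_le_mul_of_nonneg_right (Real.log_le_log h0 (by linarith)) h0.le
      rw [e7]
      linarith
    · rintro ⟨y, k⟩
      rw [hsig, cpb_L_apply]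
      simp only [kroneckerMap_apply, Matrix.one_apply, mul_ite, mul_one, mul_zero, ite_mul,
        zero_mul, Finset.sum_ite_eq, Finset.mem_univ, if_true, Complex.re_sum, ht, Finset.mul_sum]
      refine Finset.sum_congr rfl fun b _ => ?_
      simp only [Matrix.add_apply, Matrix.smul_apply, Matrix.one_apply_eq, smul_eq_mul, mul_one]
      have him : (ptraceRight τ y y).im = 0 := by
        have := (Complex.le_def.1 ((cpb_ptraceRight_psd τ hτ).diag_nonneg (i := y))).2
        simpa using this.symm
      simp only [Complex.mul_re, Complex.mul_im, Complex.add_re, Complex.add_im, him,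
        Complex.ofReal_re, Complex.ofReal_im, Complex.star_def, Complex.conj_re, Complex.conj_im,
        Complex.normSq_apply, hp]
      ring
  have hlim : Tendsto (fun η : ℝ => ∑ x, PB x * (Real.log ((p x.1 + η) * t x) - Real.log (PB x)))
      (nhdsWithin 0 (Set.Ioi 0))
      (nhds (∑ x, PB x * (Real.log (p x.1 * t x) - Real.log (PB x)))) := by
    apply tendsto_nhdsWithin_of_tendsto_nhds
    apply tendsto_finsetSum
    rintro ⟨y, k⟩ _
    rcases eq_or_ne (PB (y, k)) 0 with h0 | h0
    · simp [h0]
    have hp0 : p y ≠ 0 := by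
      intro hc
      apply h0
      have := hPBs y
      rw [hc, Finset.sum_eq_zero_iff_of_nonneg (fun k _ => hPB0 _)] at this
      exact this k (Finset.mem_univ _)
    rcases eq_or_ne (t (y, k)) 0 with h1 | h1
    · simp [h1]
    refine (Tendsto.sub_const (Tendsto.log ?_ (mul_ne_zero hp0 h1)) _).const_mul _
    refine Tendsto.mul_const _ ?_
    have : Tendsto (fun η : ℝ => p y + η) (nhds 0) (nhds (p y + 0)) :=
      tendsto_const_nhds.add tendsto_id
    simpa using this
  refine ge_of_tendsto hlim ?_
  filter_upwards [self_mem_nhdsWithin] with η hη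
  exact step η hη



lemma cpb_point (A R B t p c : ℝ) (hA : 0 ≤ A) (hR : 0 ≤ R) (hB : 0 ≤ B) (ht : 0 ≤ t)
    (hp : 0 ≤ p) (hc : 0 < c) (hAR : R = 0 → A = 0) (hBt : t = 0 → B = 0) :
    A * B / p * ((Real.log R - Real.log A) + (Real.log (p * t) - Real.log B)) ≤
      A * B / p * Real.log c + R * t / c - A * B / p := by
  by_cases h : A * B / p = 0
  · rw [h]
    have : 0 ≤ R * t / c := by positivity
    linarith
  have hp0 : 0 < p := lt_of_le_of_ne hp (fun e => h (by rw [← e]; simp))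
  have hA0 : 0 < A := lt_of_le_of_ne hA (fun e => h (by rw [← e]; simp))
  have hB0 : 0 < B := lt_of_le_of_ne hB (fun e => h (by rw [← e]; simp))
  have hR0 : 0 < R := lt_of_le_of_ne hR (fun e => hA0.ne' (hAR e.symm))
  have ht0 : 0 < t := lt_of_le_of_ne ht (fun e => hB0.ne' (hBt e.symm))
  set P := A * B / p with hP
  have hP0 : 0 < P := by positivity
  have e1 : (Real.log R - Real.log A) + (Real.log (p * t) - Real.log B)
      = Real.log c + Real.log (R * t / (P * c)) := by
    rw [hP, Real.log_mul hp0.ne' ht0.ne', Real.log_div (by positivity) (by positivity),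
      Real.log_mul hR0.ne' ht0.ne', Real.log_mul (by positivity) hc.ne',
      Real.log_div (by positivity) hp0.ne', Real.log_mul hA0.ne' hB0.ne']
    ring
  rw [e1]
  have e2 := Real.log_le_sub_one_of_pos (show 0 < R * t / (P * c) by positivity)
  have e3 := mul_le_mul_of_nonneg_left e2 hP0.le
  have e4 : P * (R * t / (P * c) - 1) = R * t / c - P := by field_simp
  rw [e4] at e3
  linarith

lemma cpb_classical {Y U V : Type*} [Fintype Y] [Fintype U] [Fintype V] [DecidableEq U]
    [DecidableEq V]
    (PA RA : Y → U → ℝ) (PB t : Y → V → ℝ) (p : Y → ℝ) (SA : Finset U) (SB : Finset V)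
    (G N DA DB NA NB : ℝ)
    (hPA : ∀ y u, 0 ≤ PA y u) (hRA : ∀ y u, 0 ≤ RA y u) (hPB : ∀ y v, 0 ≤ PB y v)
    (ht : ∀ y v, 0 ≤ t y v) (hAR : ∀ y u, RA y u = 0 → PA y u = 0)
    (hBt : ∀ y v, t y v = 0 → PB y v = 0)
    (hsA : ∀ y, ∑ u, PA y u = p y) (hsB : ∀ y, ∑ v, PB y v = p y) (hp1 : ∑ y, p y = 1)
    (hDA : 1 ≤ DA) (hDB : 1 ≤ DB) (hNA : 1 ≤ NA) (hNB : 1 ≤ NB) (hN : N = NA * NB)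
    (hRA1 : ∀ y, ∑ u ∈ SA, RA y u ≤ DA) (hRAs : ∑ y, ∑ u, RA y u = NA)
    (hts : ∀ y, ∑ v, t y v = NB) (htSB : ∑ y, ∑ v ∈ SB, t y v ≤ DB)
    (hGA : G ≤ ∑ y, ∑ u ∈ SA, PA y u) (hGB : G ≤ ∑ y, ∑ v ∈ SB, PB y v) :
    ∑ y, ∑ u, PA y u * (Real.log (RA y u) - Real.log (PA y u))
      + ∑ y, ∑ v, PB y v * (Real.log (p y * t y v) - Real.log (PB y v)) ≤
      Real.log 2 + Real.log (DA * DB) + 2 * (1 - G) * Real.log N := by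
  have hp0 : ∀ y, 0 ≤ p y := fun y => by rw [← hsA]; exact Finset.sum_nonneg fun u _ => hPA y u
  set D := DA * DB with hD
  have hD1 : 1 ≤ D := by rw [hD]; nlinarith
  have hN1 : 1 ≤ N := by rw [hN]; nlinarith
  set P3 : Y → U → V → ℝ := fun y u v => PA y u * PB y v / p y with hP3
  have hP30 : ∀ y u v, 0 ≤ P3 y u v := fun y u v =>
    div_nonneg (mul_nonneg (hPA _ _) (hPB _ _)) (hp0 y)
  have sV : ∀ y u, ∑ v, P3 y u v = PA y u := by
    intro y u
    simp only [hP3, ← Finset.sum_div, ← Finset.mul_sum, hsB]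
    rcases eq_or_ne (p y) 0 with h | h
    · have := hsA y
      rw [h, Finset.sum_eq_zero_iff_of_nonneg (fun u _ => hPA y u)] at this
      simp [this u (Finset.mem_univ _)]
    · field_simp
  have sU : ∀ y v, ∑ u, P3 y u v = PB y v := by
    intro y v
    simp only [hP3, ← Finset.sum_div, ← Finset.sum_mul, hsA]
    rcases eq_or_ne (p y) 0 with h | h
    · have := hsB y
      rw [h, Finset.sum_eq_zero_iff_of_nonneg (fun u _ => hPB y u)] at this
      simp [this v (Finset.mem_univ _)]
    · field_simp
  set gd : U → V → ℝ := fun u v => if u ∈ SA ∧ v ∈ SB then 1 else 0 with hgd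
  set c : U → V → ℝ := fun u v => if u ∈ SA ∧ v ∈ SB then 2 * D else 2 * N with hc
  have hc0 : ∀ u v, 0 < c u v := by
    intro u v; simp only [hc]; split_ifs <;> linarith
  have lhs : ∑ y, ∑ u, PA y u * (Real.log (RA y u) - Real.log (PA y u))
      + ∑ y, ∑ v, PB y v * (Real.log (p y * t y v) - Real.log (PB y v))
      = ∑ y, ∑ u, ∑ v, P3 y u v * ((Real.log (RA y u) - Real.log (PA y u))
        + (Real.log (p y * t y v) - Real.log (PB y v))) := by
    rw [← Finset.sum_add_distrib]
    refine Finset.sum_congr rfl fun y _ => ?_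
    simp only [mul_add, Finset.sum_add_distrib]
    congr 1
    · refine Finset.sum_congr rfl fun u _ => ?_
      rw [← Finset.sum_mul, sV]
    · rw [Finset.sum_comm]
      refine Finset.sum_congr rfl fun v _ => ?_
      rw [← Finset.sum_mul, sU]
  rw [lhs]
  have tot : ∑ y, ∑ u, ∑ v, P3 y u v = 1 := by simp only [sV, hsA, hp1]
  set C := ∑ y, ∑ u, ∑ v, P3 y u v * gd u v with hC
  have hgsum : ∀ f : U → V → ℝ, ∑ u, ∑ v, f u v * gd u v = ∑ u ∈ SA, ∑ v ∈ SB, f u v := by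
    intro f
    have : ∀ u, ∑ v, f u v * gd u v = if u ∈ SA then ∑ v ∈ SB, f u v else 0 := by
      intro u
      by_cases hu : u ∈ SA
      · simp [hgd, hu, Finset.sum_ite_mem]
      · simp [hgd, hu]
    simp only [this, Finset.sum_ite_mem, Finset.univ_inter]
  have hCle : C ≤ 1 := by
    rw [← tot]
    refine Finset.sum_le_sum fun y _ => Finset.sum_le_sum fun u _ => Finset.sum_le_sum fun v _ => ?_
    have : gd u v ≤ 1 := by simp only [hgd]; split_ifs <;> norm_num
    have := mul_le_mul_of_nonneg_left this (hP30 y u v)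
    linarith
  have hCge : 2 * G - 1 ≤ C := by
    have : ∀ y, ∑ u ∈ SA, PA y u + ∑ v ∈ SB, PB y v - p y ≤ ∑ u, ∑ v, P3 y u v * gd u v := by
      intro y
      rw [hgsum]
      have hα : ∑ u ∈ SA, PA y u ≤ p y := by
        rw [← hsA]; exact Finset.sum_le_univ_sum_of_nonneg (hPA y)
      have hβ : ∑ u ∈ SB, PB y u ≤ p y := by
        rw [← hsB]; exact Finset.sum_le_univ_sum_of_nonneg (hPB y)
      have hα0 : 0 ≤ ∑ u ∈ SA, PA y u := Finset.sum_nonneg fun u _ => hPA y u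
      have hβ0 : 0 ≤ ∑ u ∈ SB, PB y u := Finset.sum_nonneg fun u _ => hPB y u
      simp only [hP3, ← Finset.sum_div, ← Finset.mul_sum, ← Finset.sum_mul]
      set x := ∑ u ∈ SA, PA y u
      set z := ∑ u ∈ SB, PB y u
      rcases (hp0 y).eq_or_lt with h | h
      · rw [← h]; simp; linarith
      · rw [le_div_iff₀ h]; nlinarith
    have h2 := Finset.sum_le_sum fun y (_ : y ∈ Finset.univ) => this y
    simp only [Finset.sum_sub_distrib, Finset.sum_add_distrib, hp1] at h2
    linarith
  have hgood : ∑ y, ∑ u, ∑ v, RA y u * t y v * gd u v ≤ D := by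
    simp only [hgsum, ← Finset.mul_sum, ← Finset.sum_mul]
    calc ∑ y, (∑ u ∈ SA, RA y u) * ∑ v ∈ SB, t y v ≤ ∑ y, DA * ∑ v ∈ SB, t y v :=
          Finset.sum_le_sum fun y _ => mul_le_mul_of_nonneg_right (hRA1 y)
            (Finset.sum_nonneg fun v _ => ht y v)
      _ = DA * ∑ y, ∑ v ∈ SB, t y v := by rw [Finset.mul_sum]
      _ ≤ DA * DB := mul_le_mul_of_nonneg_left htSB (by linarith)
  have hall : ∑ y, ∑ u, ∑ v, RA y u * t y v = N := by
    simp only [← Finset.mul_sum, ← Finset.sum_mul, hts, hRAs, hN]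
  have hlast : ∀ y u v, P3 y u v * ((Real.log (RA y u) - Real.log (PA y u))
        + (Real.log (p y * t y v) - Real.log (PB y v))) ≤
      (P3 y u v * gd u v * (Real.log D - Real.log N) + P3 y u v * (Real.log 2 + Real.log N)
        + (RA y u * t y v * gd u v) * (1 / (2 * D))
        + (RA y u * t y v) * (1 / (2 * N))) - P3 y u v := by
    intro y u v
    have h1 := cpb_point (PA y u) (RA y u) (PB y v) (t y v) (p y) (c u v) (hPA _ _) (hRA _ _)
      (hPB _ _) (ht _ _) (hp0 _) (hc0 u v) (hAR y u) (hBt y v)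
    have hRt : 0 ≤ RA y u * t y v := mul_nonneg (hRA _ _) (ht _ _)
    have hn : 0 ≤ RA y u * t y v * (1 / (2 * N)) := by positivity
    refine h1.trans ?_
    by_cases hg : u ∈ SA ∧ v ∈ SB
    · simp only [hc, hgd, if_pos hg]
      rw [Real.log_mul (by norm_num) (by linarith)]
      simp only [div_eq_mul_inv, one_mul, mul_one] at hn ⊢
      simp only [hP3, div_eq_mul_inv]
      nlinarith
    · simp only [hc, hgd, if_neg hg]
      rw [Real.log_mul (by norm_num) (by linarith)]
      simp only [div_eq_mul_inv, one_mul, mul_one] at hn ⊢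
      simp only [hP3, div_eq_mul_inv]
      nlinarith
  refine (Finset.sum_le_sum fun y _ => Finset.sum_le_sum fun u _ => Finset.sum_le_sum fun v _ =>
    hlast y u v).trans ?_
  simp only [Finset.sum_sub_distrib, Finset.sum_add_distrib, ← Finset.sum_mul]
  simp only [← hC, tot, hall]
  have f1 : (∑ y, ∑ u, ∑ v, RA y u * t y v * gd u v) * (1 / (2 * D)) ≤ 1 / 2 := by
    refine (mul_le_mul_of_nonneg_right hgood (by positivity)).trans (le_of_eq ?_)
    field_simp
  have f2 : N * (1 / (2 * N)) = 1 / 2 := by field_simp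
  rw [f2]
  have hlD : 0 ≤ Real.log D := Real.log_nonneg hD1
  have hlN : 0 ≤ Real.log N := Real.log_nonneg hN1
  nlinarith [mul_nonneg (sub_nonneg.2 hCle) hlD, mul_nonneg (sub_nonneg.2 hCge) hlN]

lemma cpb_traceNorm {ι : Type*} [Fintype ι] [DecidableEq ι] (K ω : Matrix ι ι ℂ)
    (hK : K * Kᴴ = 1) : (K * ω).trace.re ≤ traceNorm ω := by
  have hM := Matrix.posSemidef_conjTranspose_mul_self ω
  have hV2 : (hM.1.eigenvectorUnitary.1)ᴴ * hM.1.eigenvectorUnitary.1 = 1 :=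
    Unitary.coe_star_mul_self hM.1.eigenvectorUnitary
  have hV : hM.1.eigenvectorUnitary.1 * (hM.1.eigenvectorUnitary.1)ᴴ = 1 :=
    Unitary.coe_mul_star_self hM.1.eigenvectorUnitary
  have hsp : ωᴴ * ω = hM.1.eigenvectorUnitary.1 *
    diagonal (fun i => (hM.1.eigenvalues i : ℂ)) * (hM.1.eigenvectorUnitary.1)ᴴ :=
    hM.1.spectral_theorem
  have hn : traceNorm ω = ∑ i, Real.sqrt (hM.1.eigenvalues i) := by
    unfold traceNorm Matrix.PosSemidef.sqrt
    have : ((hM.1.eigenvectorUnitary.1) * diagonal (fun i => ((Real.sqrt (hM.1.eigenvalues i) : ℝ) : ℂ))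
      * (hM.1.eigenvectorUnitary.1)ᴴ).trace.re = ∑ i, Real.sqrt (hM.1.eigenvalues i) := by
      rw [trace_mul_comm, ← Matrix.mul_assoc, hV2, Matrix.one_mul, trace_diagonal, Complex.re_sum]
      simp
    exact this
  rw [hn]
  revert hV2 hV hsp
  generalize hM.1.eigenvectorUnitary.1 = V
  generalize hM.1.eigenvalues = d
  intro hV2 hV hsp
  have e1 : (K * ω).trace = ((Vᴴ * K) * (ω * V)).trace := by
    rw [Matrix.mul_assoc Vᴴ, trace_mul_comm Vᴴ, Matrix.mul_assoc K, Matrix.mul_assoc ω, hV,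
      Matrix.mul_one]
  rw [e1, cpb_tr_mul]
  have hA : (Vᴴ * K) * (Vᴴ * K)ᴴ = 1 := by
    rw [conjTranspose_mul, conjTranspose_conjTranspose, Matrix.mul_assoc, ← Matrix.mul_assoc K,
      hK, Matrix.one_mul, hV2]
  have hB : (ω * V)ᴴ * (ω * V) = diagonal (fun i => (d i : ℂ)) := by
    rw [conjTranspose_mul, Matrix.mul_assoc, ← Matrix.mul_assoc ωᴴ, hsp, Matrix.mul_assoc,
      Matrix.mul_assoc, hV2, Matrix.mul_one, ← Matrix.mul_assoc, hV2, Matrix.one_mul]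
  revert hA hB
  generalize Vᴴ * K = A
  generalize ω * V = F
  intro hA hB
  refine Finset.sum_le_sum fun i _ => ?_
  have hA1 : ∑ j, ‖A i j‖ ^ 2 = 1 := by
    have h := congrArg Complex.re (congrFun (congrFun hA i) i)
    rw [Matrix.mul_apply, Complex.re_sum, Matrix.one_apply_eq, Complex.one_re] at h
    rw [← h]
    refine Finset.sum_congr rfl fun j _ => ?_
    rw [← Complex.normSq_eq_norm_sq]
    simp [Complex.normSq_apply]
  have hB1 : ∑ j, ‖F j i‖ ^ 2 = d i := by
    have h := congrArg Complex.re (congrFun (congrFun hB i) i)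
    rw [Matrix.mul_apply, Complex.re_sum, diagonal_apply_eq, Complex.ofReal_re] at h
    rw [← h]
    refine Finset.sum_congr rfl fun j _ => ?_
    rw [← Complex.normSq_eq_norm_sq]
    simp [Complex.normSq_apply]
  calc ∑ j, (A i j * F j i).re ≤ ∑ j, ‖A i j‖ * ‖F j i‖ := by
        refine Finset.sum_le_sum fun j _ => ?_
        rw [← norm_mul]; exact Complex.re_le_norm _
    _ ≤ Real.sqrt (∑ j, ‖A i j‖ ^ 2) * Real.sqrt (∑ j, ‖F j i‖ ^ 2) :=
        Real.sum_mul_le_sqrt_mul_sqrt _ _ _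
    _ = Real.sqrt (d i) := by rw [hA1, hB1]; simp



lemma cpb_tpow_mul {ι : Type*} [Fintype ι] [DecidableEq ι] (M N : Matrix ι ι ℂ) (n : ℕ) :
    tpow (M * N) n = tpow M n * tpow N n := by
  ext x y
  simp only [tpow, Matrix.mul_apply]
  rw [Finset.prod_univ_sum, Fintype.piFinset_univ]
  simp only [Finset.prod_mul_distrib]

lemma cpb_tpow_diagonal {ι : Type*} [Fintype ι] [DecidableEq ι] (d : ι → ℂ) (n : ℕ) :
    tpow (diagonal d) n = diagonal (fun x => ∏ k, d (x k)) := by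
  ext x y
  simp only [tpow]
  by_cases h : x = y
  · subst h; simp
  · obtain ⟨k, hk⟩ := Function.ne_iff.1 h
    rw [diagonal_apply_ne _ h]
    exact Finset.prod_eq_zero (Finset.mem_univ k) (diagonal_apply_ne _ hk)

lemma cpb_tpow_one {ι : Type*} [Fintype ι] [DecidableEq ι] (n : ℕ) :
    tpow (1 : Matrix ι ι ℂ) n = 1 := by
  rw [← Matrix.diagonal_one, cpb_tpow_diagonal]; simp

lemma cpb_tpow_conj {ι : Type*} (M : Matrix ι ι ℂ) (n : ℕ) :
    tpow Mᴴ n = (tpow M n)ᴴ := by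
  ext x y
  simp [tpow]

lemma cpb_tpow_psd {ι : Type*} [Fintype ι] [DecidableEq ι] (M : Matrix ι ι ℂ) (n : ℕ)
    (h : M.PosSemidef) : (tpow M n).PosSemidef := by
  obtain ⟨V, l, hV2, hV, hl, h⟩ := cpb_exists_diag M h
  rw [h, cpb_tpow_mul, cpb_tpow_mul, cpb_tpow_conj, cpb_tpow_diagonal]
  apply PosSemidef.mul_mul_conjTranspose_same
  apply PosSemidef.diagonal
  intro x
  have : ∏ k, ((l (x k) : ℝ) : ℂ) = ((∏ k, l (x k) : ℝ) : ℂ) := by push_cast; rfl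
  simp only [this]
  exact Complex.zero_le_real.2 (Finset.prod_nonneg fun k _ => hl (x k))

lemma cpb_sum_prod_log {ι : Type*} [Fintype ι] (l : ι → ℝ)
    (hs : ∑ i, l i = 1) (n : ℕ) :
    ∑ x : Fin n → ι, (∏ k, l (x k)) * Real.log (∏ k, l (x k)) = n * ∑ i, l i * Real.log (l i) := by
  induction n with
  | zero => simp
  | succ n ih =>
    rw [← (Fin.consEquiv (fun _ : Fin (n+1) => ι)).sum_comp, Fintype.sum_prod_type]
    have hs1 : ∑ x : Fin n → ι, ∏ k, l (x k) = 1 := by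
      classical
      have := Finset.prod_univ_sum (fun _ : Fin n => (Finset.univ : Finset ι)) (fun _ i => l i)
      rw [Fintype.piFinset_univ] at this
      rw [← this]; simp [hs]
    have : ∀ (i : ι) (x : Fin n → ι), (∏ k, l ((Fin.consEquiv (fun _ : Fin (n+1) => ι)) (i, x) k)) *
        Real.log (∏ k, l ((Fin.consEquiv (fun _ : Fin (n+1) => ι)) (i, x) k))
        = (l i * Real.log (l i)) * (∏ k, l (x k))
          + l i * ((∏ k, l (x k)) * Real.log (∏ k, l (x k))) := by
      intro i x
      rw [Fin.prod_univ_succ]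
      simp only [Fin.consEquiv_apply, Fin.cons_zero, Fin.cons_succ]
      rcases eq_or_ne (l i) 0 with h | h
      · simp [h]
      rcases eq_or_ne (∏ k, l (x k)) 0 with h' | h'
      · simp [h']
      rw [Real.log_mul h h']; ring
    simp only [this, Finset.sum_add_distrib, ← Finset.mul_sum, hs1, ih, ← Finset.sum_mul, hs]
    push_cast; ring

lemma cpb_entropy_tpow {ι : Type*} [Fintype ι] [DecidableEq ι] (M : Matrix ι ι ℂ) (n : ℕ)
    (h : M.PosSemidef) (htr : M.trace = 1) : entropy (tpow M n) = n * entropy M := by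
  obtain ⟨V, l, hV2, hV, hl, h⟩ := cpb_exists_diag M h
  have hs : ∑ i, l i = 1 := by
    rw [h, trace_mul_comm, ← Matrix.mul_assoc, hV2, Matrix.one_mul, trace_diagonal] at htr
    exact_mod_cast htr
  have h2 : tpow M n = tpow V n * diagonal (fun x => ((∏ k, l (x k) : ℝ) : ℂ)) * (tpow V n)ᴴ := by
    rw [h, cpb_tpow_mul, cpb_tpow_mul, cpb_tpow_conj, cpb_tpow_diagonal]
    push_cast; rfl
  have h3 : (tpow V n)ᴴ * tpow V n = 1 := by
    rw [← cpb_tpow_conj, ← cpb_tpow_mul, hV2, cpb_tpow_one]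
  rw [cpb_entropy_diag _ _ _ h3 h2, cpb_entropy_diag _ _ _ hV2 h, cpb_sum_prod_log l hs]
  ring

lemma cpb_ptraceRight_trace {γ μ : Type*} [Fintype γ] [Fintype μ]
    (τ : Matrix (γ × μ) (γ × μ) ℂ) : (ptraceRight τ).trace = τ.trace := by
  simp [ptraceRight, trace, Fintype.sum_prod_type]

lemma cpb_ptraceLeft_trace {γ μ : Type*} [Fintype γ] [Fintype μ]
    (τ : Matrix (γ × μ) (γ × μ) ℂ) : (ptraceLeft τ).trace = τ.trace := by
  simp only [ptraceLeft, trace, Matrix.diag, Fintype.sum_prod_type]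
  rw [Finset.sum_comm]

lemma cpb_ptraceLeft_psd {γ μ : Type*} [Fintype γ] [DecidableEq γ] [Fintype μ]
    [DecidableEq μ] (τ : Matrix (γ × μ) (γ × μ) ℂ) (h : τ.PosSemidef) :
    (ptraceLeft τ).PosSemidef := by
  have : ptraceLeft τ = ∑ b, τ.submatrix (fun a => (b, a)) (fun a => (b, a)) := by
    ext i j
    rw [Matrix.sum_apply]
    rfl
  rw [this]
  exact Matrix.posSemidef_sum _ fun b _ => h.submatrix _

lemma cpb_ptraceRight_tpowAB {α β : Type*} [Fintype α] [DecidableEq α] [Fintype β]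
    [DecidableEq β] (ρ : Matrix (α × β) (α × β) ℂ) (n : ℕ) :
    ptraceRight (tpowAB ρ n) = tpow (ptraceRight ρ) n := by
  ext x y
  simp only [ptraceRight, tpowAB, tpow, Matrix.reindex_apply, Matrix.submatrix_apply]
  rw [Finset.prod_univ_sum, Fintype.piFinset_univ]
  rfl

lemma cpb_ptraceLeft_tpowAB {α β : Type*} [Fintype α] [DecidableEq α] [Fintype β]
    [DecidableEq β] (ρ : Matrix (α × β) (α × β) ℂ) (n : ℕ) :
    ptraceLeft (tpowAB ρ n) = tpow (ptraceLeft ρ) n := by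
  ext x y
  simp only [ptraceLeft, tpowAB, tpow, Matrix.reindex_apply, Matrix.submatrix_apply]
  rw [Finset.prod_univ_sum, Fintype.piFinset_univ]
  rfl



lemma cpb_ptraceRight_kron2 {γ δ μ : Type*} [Fintype γ] [Fintype δ] [Fintype μ]
    [DecidableEq μ] (σ : Matrix (δ × μ) (δ × μ) ℂ) (J : Matrix γ δ ℂ) :
    ptraceRight ((J ⊗ₖ (1 : Matrix μ μ ℂ)) * σ * (J ⊗ₖ (1 : Matrix μ μ ℂ))ᴴ)
      = J * ptraceRight σ * Jᴴ := by
  ext i j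
  simp only [ptraceRight, Matrix.mul_apply, Fintype.sum_prod_type, conjTranspose_apply,
    kroneckerMap_apply, Matrix.one_apply]
  simp only [mul_ite, mul_one, mul_zero, Finset.sum_ite_eq, Finset.mem_univ, if_true,
    apply_ite star, star_zero, ite_mul, zero_mul]
  rw [Finset.sum_comm]
  refine Finset.sum_congr rfl fun x _ => ?_
  simp only [Finset.sum_mul, Finset.mul_sum]
  rw [Finset.sum_comm]

lemma cpb_ptraceLeft_kron2 {γ δ μ : Type*} [Fintype γ] [Fintype δ] [DecidableEq δ] [Fintype μ]
    [DecidableEq μ] (σ : Matrix (δ × μ) (δ × μ) ℂ) (J : Matrix γ δ ℂ) (hJ : Jᴴ * J = 1) :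
    ptraceLeft ((J ⊗ₖ (1 : Matrix μ μ ℂ)) * σ * (J ⊗ₖ (1 : Matrix μ μ ℂ))ᴴ)
      = ptraceLeft σ := by
  ext i j
  simp only [ptraceLeft, Matrix.mul_apply, Fintype.sum_prod_type, conjTranspose_apply,
    kroneckerMap_apply, Matrix.one_apply]
  simp only [mul_ite, mul_one, mul_zero, Finset.sum_ite_eq, Finset.mem_univ, if_true,
    apply_ite star, star_zero, ite_mul, zero_mul]
  have h : ∀ d d', ∑ x, star (J x d) * J x d' = if d = d' then 1 else 0 := fun d d' => by
    have := congrFun (congrFun hJ d) d'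
    rw [Matrix.mul_apply, Matrix.one_apply] at this
    exact this
  rw [Finset.sum_comm]
  refine Finset.sum_congr rfl fun d _ => ?_
  simp only [Finset.sum_mul]
  rw [Finset.sum_comm]
  have : ∀ d', ∑ x, J x d' * σ (d', i) (d, j) * star (J x d)
      = if d = d' then σ (d', i) (d, j) else 0 := by
    intro d'
    have e : ∑ x, J x d' * σ (d', i) (d, j) * star (J x d)
      = σ (d', i) (d, j) * ∑ x, star (J x d) * J x d' := by
      rw [Finset.mul_sum]; exact Finset.sum_congr rfl fun k _ => by ring
    rw [e, h]; simp
  simp only [this, Finset.sum_ite_eq, Finset.mem_univ, if_true]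

lemma cpb_row_norm {ι κ : Type*} [Fintype ι] (J : Matrix κ ι ℂ) (x : κ) :
    ((J * Jᴴ) x x).re = ∑ i, Complex.normSq (J x i) := by
  rw [Matrix.mul_apply, Complex.re_sum]
  refine Finset.sum_congr rfl fun i _ => ?_
  simp [Complex.normSq_apply]

lemma cpb_col_norm {ι κ : Type*} [Fintype κ] (J : Matrix κ ι ℂ) (x : ι) :
    ((Jᴴ * J) x x).re = ∑ i, Complex.normSq (J i x) := by
  rw [Matrix.mul_apply, Complex.re_sum]
  refine Finset.sum_congr rfl fun i _ => ?_
  simp [Complex.normSq_apply]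

lemma cpb_row_le {ι κ : Type*} [Fintype ι] [DecidableEq ι] [Fintype κ] [DecidableEq κ]
    (J : Matrix κ ι ℂ) (hJ : Jᴴ * J = 1) (x : κ) : ((J * Jᴴ) x x).re ≤ 1 := by
  set K : Matrix κ κ ℂ := 1 - J * Jᴴ with hK
  have hKh : Kᴴ = K := by
    simp [hK]
  have hKK : K * Kᴴ = K := by
    have : J * Jᴴ * (J * Jᴴ) = J * Jᴴ := by
      rw [Matrix.mul_assoc, ← Matrix.mul_assoc Jᴴ, hJ, Matrix.one_mul]
    rw [hKh, hK, Matrix.sub_mul, Matrix.mul_sub, Matrix.mul_sub, this]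
    simp
  have h := cpb_diag_re_nonneg (Matrix.posSemidef_self_mul_conjTranspose K) x
  rw [hKK, hK, Matrix.sub_apply, Matrix.one_apply_eq, Complex.sub_re, Complex.one_re] at h
  linarith

lemma cpb_card_filter {a g : Type*} [Fintype a] [DecidableEq a] [Fintype g] (a0 : a) :
    ∑ u ∈ Finset.univ.filter (fun u : a × g => u.1 = a0), (1 : ℝ) = Fintype.card g := by
  rw [Finset.sum_filter, Fintype.sum_prod_type, Finset.sum_eq_single a0]
  · simp
  · intro b _ hb
    simp [hb]
  · simp

/-- joint block -/
def cpb_blk {a y g μ : Type*}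
    (ω : Matrix (((a × y) × g) × μ) (((a × y) × g) × μ) ℂ) (u : a × g) :
    Matrix (y × μ) (y × μ) ℂ :=
  (Matrix.reindex (pullYB a y g μ) (pullYB a y g μ) ω).submatrix (fun z => (z, u)) (fun z => (z, u))

lemma cpb_core {A μ a y g p q : Type*} [Fintype A] [DecidableEq A] [Fintype μ] [DecidableEq μ]
    [Fintype a] [DecidableEq a] [Fintype y] [DecidableEq y] [Fintype g] [DecidableEq g]
    [Fintype p] [DecidableEq p] [Fintype q] [DecidableEq q] [Nonempty g] [Nonempty q]
    [Nonempty A] [Nonempty μ]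
    (σ : Matrix (A × μ) (A × μ) ℂ) (hσ : σ.PosSemidef) (hσ1 : σ.trace = 1)
    (J : Matrix ((a × y) × g) A ℂ) (hJ : Jᴴ * J = 1) (U : Matrix (p × q) (μ × y) ℂ)
    (hU : Uᴴ * U = 1) (hU2 : U * Uᴴ = 1)
    (ω : Matrix (((a × y) × g) × μ) (((a × y) × g) × μ) ℂ)
    (hω : ω = (J ⊗ₖ (1 : Matrix μ μ ℂ)) * σ * (J ⊗ₖ (1 : Matrix μ μ ℂ))ᴴ)
    (a0 : a) (p0 : p) (G : ℝ)
    (hG : G = ∑ y', ∑ g' : g, ∑ q' : q,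
      ((cpb_L U * cpb_blk ω (a0, g') * (cpb_L U)ᴴ) (y', (p0, q')) (y', (p0, q'))).re) :
    entropy (ptraceRight σ) +
      (entropy (ptraceRight (Matrix.reindex (pullYB a y g μ) (pullYB a y g μ) ω)) -
      entropy (ptraceRight (ptraceRight (Matrix.reindex (pullYB a y g μ) (pullYB a y g μ) ω)))) ≤
    Real.log 2 + Real.log ((Fintype.card g : ℝ) * Fintype.card q)
      + 2 * (1 - G) * Real.log ((Fintype.card A : ℝ) * Fintype.card μ) := by
  have hωp : ω.PosSemidef := by rw [hω]; exact hσ.mul_mul_conjTranspose_same _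
  have hbp : ∀ u, (cpb_blk ω u).PosSemidef := fun u => by
    unfold cpb_blk
    rw [Matrix.reindex_apply]
    exact (hωp.submatrix _).submatrix _
  set τ := ptraceRight (Matrix.reindex (pullYB a y g μ) (pullYB a y g μ) ω) with hτ
  have hτs : τ = ∑ u, cpb_blk ω u := by
    ext i j
    rw [Matrix.sum_apply]
    rfl
  have hτp : τ.PosSemidef := by rw [hτs]; exact Matrix.posSemidef_sum _ fun u _ => hbp u
  have hPAe : J * ptraceRight σ * Jᴴ = ptraceRight ω := by rw [hω, cpb_ptraceRight_kron2]
  have hsp : (ptraceRight σ).PosSemidef := cpb_ptraceRight_psd σ hσ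
  have hA := cpb_aside J hJ (ptraceRight σ) hsp
  have hB := cpb_bside U hU τ hτp
  set gj : y → a × g → p × q → ℝ := fun y' u k =>
    ((cpb_L U * cpb_blk ω u * (cpb_L U)ᴴ) (y', k) (y', k)).re with hgj
  have hgj0 : ∀ y' u k, 0 ≤ gj y' u k := fun y' u k =>
    cpb_diag_re_nonneg ((hbp u).mul_mul_conjTranspose_same _) _
  set PA : y → a × g → ℝ := fun y' u =>
    ((J * ptraceRight σ * Jᴴ) ((u.1, y'), u.2) ((u.1, y'), u.2)).re with hPA
  set RA : y → a × g → ℝ := fun y' u => ((J * Jᴴ) ((u.1, y'), u.2) ((u.1, y'), u.2)).re with hRA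
  set PB : y → p × q → ℝ := fun y' k => ((cpb_L U * τ * (cpb_L U)ᴴ) (y', k) (y', k)).re with hPB
  set t : y → p × q → ℝ := fun y' k => ∑ b, Complex.normSq (U k (b, y')) with ht
  set pp : y → ℝ := fun y' => (ptraceRight τ y' y').re with hpp
  have gA : ∀ y' u, ∑ k, gj y' u k = PA y' u := by
    intro y' u
    simp only [hgj, hPA, hPAe]
    rw [← Complex.re_sum, cpb_L_sum U hU]
    rfl
  have gB : ∀ y' k, ∑ u, gj y' u k = PB y' k := by
    intro y' k
    simp only [hgj, hPB, hτs]
    rw [← Complex.re_sum, Matrix.mul_sum, Matrix.sum_mul, Matrix.sum_apply]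
  have hsB : ∀ y', ∑ k, PB y' k = pp y' := by
    intro y'
    simp only [hPB, hpp]
    rw [← Complex.re_sum, cpb_L_sum U hU]
  have hsA : ∀ y', ∑ u, PA y' u = pp y' := by
    intro y'
    simp only [← gA]
    rw [Finset.sum_comm]
    simp only [gB, hsB]
  have resum : ∀ f : (a × y) × g → ℝ, ∑ x, f x = ∑ y', ∑ u : a × g, f ((u.1, y'), u.2) := by
    intro f
    simp only [Fintype.sum_prod_type]
    rw [Finset.sum_comm]
  have hp1 : ∑ y', pp y' = 1 := by
    have h1 : (J * ptraceRight σ * Jᴴ).trace = 1 := by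
      rw [trace_mul_comm, ← Matrix.mul_assoc, hJ, Matrix.one_mul, cpb_ptraceRight_trace, hσ1]
    have h2 := congrArg Complex.re h1
    simp only [trace, Matrix.diag, Complex.re_sum, Complex.one_re] at h2
    rw [resum] at h2
    rw [← h2]
    exact Finset.sum_congr rfl fun y' _ => (hsA y').symm
  have hcl := cpb_classical PA RA PB t pp
    (Finset.univ.filter fun u : a × g => u.1 = a0) (Finset.univ.filter fun k : p × q => k.1 = p0)
    G _ (Fintype.card g) (Fintype.card q) (Fintype.card A) (Fintype.card μ)
    (fun y' u => by rw [← gA]; exact Finset.sum_nonneg fun k _ => hgj0 _ _ _)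
    (fun y' u => by
      simp only [hRA]; rw [cpb_row_norm]; exact Finset.sum_nonneg fun k _ => Complex.normSq_nonneg _)
    (fun y' k => by rw [← gB]; exact Finset.sum_nonneg fun k _ => hgj0 _ _ _)
    (fun y' k => Finset.sum_nonneg fun k _ => Complex.normSq_nonneg _)
    ?_ ?_ hsA hsB hp1
    (by exact_mod_cast Fintype.card_pos) (by exact_mod_cast Fintype.card_pos)
    (by exact_mod_cast Fintype.card_pos) (by exact_mod_cast Fintype.card_pos) rfl
    ?_ ?_ ?_ ?_ ?_ ?_
  · refine le_trans ?_ hcl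
    refine add_le_add ?_ ?_
    · refine hA.trans (le_of_eq ?_)
      rw [resum]
    · refine hB.trans (le_of_eq ?_)
      rw [Fintype.sum_prod_type]
  · -- RA = 0
    intro y' u h
    simp only [hRA] at h
    rw [cpb_row_norm, Finset.sum_eq_zero_iff_of_nonneg (fun _ _ => Complex.normSq_nonneg _)] at h
    have h1 : ∀ i, J ((u.1, y'), u.2) i = 0 := fun i =>
      Complex.normSq_eq_zero.1 (h i (Finset.mem_univ _))
    simp only [hPA]
    rw [Matrix.mul_assoc, Matrix.mul_apply]
    simp [h1]
  · intro y' k h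
    simp only [ht] at h
    rw [Finset.sum_eq_zero_iff_of_nonneg (fun _ _ => Complex.normSq_nonneg _)] at h
    have h1 : ∀ b, U k (b, y') = 0 := fun i =>
      Complex.normSq_eq_zero.1 (h i (Finset.mem_univ _))
    simp only [hPB]
    rw [cpb_L_apply]
    simp [h1]
  · intro y'
    calc ∑ u ∈ Finset.univ.filter (fun u : a × g => u.1 = a0), RA y' u
        ≤ ∑ u ∈ Finset.univ.filter (fun u : a × g => u.1 = a0), 1 :=
          Finset.sum_le_sum fun u _ => cpb_row_le J hJ _
      _ = Fintype.card g := cpb_card_filter a0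
  · have h1 : (Jᴴ * J).trace.re = Fintype.card A := by rw [hJ]; simp
    rw [trace_mul_comm] at h1
    simp only [trace, Matrix.diag, Complex.re_sum] at h1
    rw [resum] at h1
    exact h1
  · intro y'
    simp only [ht]
    rw [Finset.sum_comm]
    have : ∀ b, ∑ k, Complex.normSq (U k (b, y')) = 1 := fun b => by
      rw [← cpb_col_norm, hU]; simp
    simp [this]
  · refine le_of_eq ?_
    have h1 : ∀ k, ∑ y', t y' k = 1 := by
      intro k
      have h2 := cpb_row_norm U k
      rw [hU2, Fintype.sum_prod_type, Finset.sum_comm] at h2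
      simp only [ht]
      rw [← h2]; simp
    rw [Finset.sum_comm]
    simp only [h1]
    exact cpb_card_filter p0
  · rw [hG]
    refine Finset.sum_le_sum fun y' _ => ?_
    rw [Finset.sum_filter, Fintype.sum_prod_type, Finset.sum_eq_single a0]
    · simp only [if_true]
      refine Finset.sum_le_sum fun g' _ => ?_
      rw [← gA, Fintype.sum_prod_type]
      exact Finset.single_le_sum (f := fun p' => ∑ q', gj y' (a0, g') (p', q'))
        (fun p' _ => Finset.sum_nonneg fun q' _ => hgj0 _ _ _) (Finset.mem_univ p0)
    · intro b _ hb; simp [hb]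
    · simp
  · rw [hG]
    refine Finset.sum_le_sum fun y' _ => ?_
    rw [Finset.sum_comm]
    rw [Finset.sum_filter, Fintype.sum_prod_type, Finset.sum_eq_single p0]
    · simp only [if_true]
      refine Finset.sum_le_sum fun q' _ => ?_
      rw [← gB, Fintype.sum_prod_type]
      exact Finset.single_le_sum (f := fun a' => ∑ g', gj y' (a', g') (p0, q'))
        (fun p' _ => Finset.sum_nonneg fun q' _ => hgj0 _ _ _) (Finset.mem_univ a0)
    · intro b _ hb; simp [hb]
    · simp



lemma cpb_kron_diag {κ ζ r : Type*} [Fintype ζ] [Fintype r] [DecidableEq r]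
    (U : Matrix κ ζ ℂ) (M : Matrix (ζ × r) (ζ × r) ℂ) (k : κ) (x : r) :
    ((U ⊗ₖ (1 : Matrix r r ℂ)) * M * (U ⊗ₖ (1 : Matrix r r ℂ))ᴴ) (k, x) (k, x)
      = ∑ z, ∑ z', U k z * M (z, x) (z', x) * star (U k z') := by
  simp only [Matrix.mul_apply, Fintype.sum_prod_type, conjTranspose_apply,
    kroneckerMap_apply, Matrix.one_apply]
  simp only [mul_ite, mul_one, mul_zero, Finset.sum_ite_eq, Finset.mem_univ, if_true,
    apply_ite star, star_zero, ite_mul, zero_mul]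
  rw [Finset.sum_comm]
  simp only [Finset.sum_mul]

section cpb
variable {α β : Type*} [Fintype α] [DecidableEq α] [Fintype β] [DecidableEq β]

def cpb_J {n : ℕ} (Pr : Protocol α β n) :
    Matrix ((Fin Pr.dAp × Fin Pr.dY) × Fin Pr.dAg) (Fin n → α) ℂ :=
  Pr.UA * (1 : Matrix ((Fin n → α) × Fin Pr.dC) ((Fin n → α) × Fin Pr.dC) ℂ).submatrix id
    (fun a => (a, ⟨0, Pr.dC_pos⟩))

lemma cpb_J_iso {n : ℕ} (Pr : Protocol α β n) : (cpb_J Pr)ᴴ * cpb_J Pr = 1 := by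
  unfold cpb_J
  rw [conjTranspose_mul, Matrix.mul_assoc, ← Matrix.mul_assoc Pr.UAᴴ, Pr.UA_unitary.1,
    Matrix.one_mul]
  ext x y
  rw [Matrix.mul_apply]
  simp [Matrix.one_apply, eq_comm]

lemma cpb_inputState {n : ℕ} (ρ : Matrix (α × β) (α × β) ℂ) (Pr : Protocol α β n) :
    inputState ρ Pr =
      ((1 : Matrix ((Fin n → α) × Fin Pr.dC) ((Fin n → α) × Fin Pr.dC) ℂ).submatrix id
        (fun a => (a, ⟨0, Pr.dC_pos⟩)) ⊗ₖ (1 : Matrix (Fin n → β) (Fin n → β) ℂ)) *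
      tpowAB ρ n *
      ((1 : Matrix ((Fin n → α) × Fin Pr.dC) ((Fin n → α) × Fin Pr.dC) ℂ).submatrix id
        (fun a => (a, ⟨0, Pr.dC_pos⟩)) ⊗ₖ (1 : Matrix (Fin n → β) (Fin n → β) ℂ))ᴴ := by
  have hz : ∀ c : Fin Pr.dC, c = ⟨0, Pr.dC_pos⟩ ↔ c.val = 0 := fun c => by
    rw [Fin.ext_iff]
  ext ⟨⟨x, c⟩, b⟩ ⟨⟨x', c'⟩, b'⟩
  simp only [Matrix.mul_apply, Fintype.sum_prod_type, conjTranspose_apply,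
    kroneckerMap_apply, Matrix.one_apply, Matrix.submatrix_apply, id]
  simp only [mul_ite, mul_one, mul_zero, Finset.sum_ite_eq, Finset.mem_univ, if_true,
    apply_ite star, star_zero, star_one, ite_mul, zero_mul, one_mul, Prod.mk.injEq, hz, ite_and]
  simp only [inputState, swapE, pureZero, Matrix.reindex_apply, Matrix.submatrix_apply,
    kroneckerMap_apply, Equiv.coe_fn_symm_mk]
  by_cases h1 : c.val = 0 <;> by_cases h2 : c'.val = 0 <;> simp [h1, h2]

lemma cpb_stateUA {n : ℕ} (ρ : Matrix (α × β) (α × β) ℂ) (Pr : Protocol α β n) :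
    stateAfterUA ρ Pr = (cpb_J Pr ⊗ₖ (1 : Matrix (Fin n → β) (Fin n → β) ℂ)) * tpowAB ρ n *
      (cpb_J Pr ⊗ₖ (1 : Matrix (Fin n → β) (Fin n → β) ℂ))ᴴ := by
  have : cpb_J Pr ⊗ₖ (1 : Matrix (Fin n → β) (Fin n → β) ℂ) =
    (Pr.UA ⊗ₖ (1 : Matrix (Fin n → β) (Fin n → β) ℂ)) *
    ((1 : Matrix ((Fin n → α) × Fin Pr.dC) ((Fin n → α) × Fin Pr.dC) ℂ).submatrix id
        (fun a => (a, ⟨0, Pr.dC_pos⟩)) ⊗ₖ (1 : Matrix (Fin n → β) (Fin n → β) ℂ)) := by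
    rw [← mul_kronecker_mul, Matrix.one_mul]; rfl
  rw [this, conjTranspose_mul]
  unfold stateAfterUA
  rw [cpb_inputState]
  simp only [Matrix.mul_assoc]

lemma cpb_output {n : ℕ} (ρ : Matrix (α × β) (α × β) ℂ) (Pr : Protocol α β n)
    (a : Fin Pr.dAp) (p : Fin Pr.dBp) :
    outputReduced ρ Pr (a, p) (a, p) = ∑ y, ∑ g, ∑ q,
      (cpb_L Pr.UB * cpb_blk (stateAfterUA ρ Pr) (a, g) * (cpb_L Pr.UB)ᴴ) (y, (p, q)) (y, (p, q)) := by
  have h : ∀ g q, stateAfterUB ρ Pr ((p, q), (a, g)) ((p, q), (a, g)) = ∑ y,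
      (cpb_L Pr.UB * cpb_blk (stateAfterUA ρ Pr) (a, g) * (cpb_L Pr.UB)ᴴ) (y, (p, q)) (y, (p, q)) := by
    intro g q
    simp only [cpb_L_apply]
    unfold stateAfterUB stateAfterDephasing
    generalize stateAfterUA ρ Pr = ω
    rw [cpb_kron_diag]
    simp only [Fintype.sum_prod_type]
    simp only [Matrix.reindex_apply, Matrix.submatrix_apply, dephaseFst, pullY, pullBY, cpb_blk,
      pullYB, Equiv.coe_fn_mk, Equiv.symm_mk]
    simp only [mul_ite, mul_zero, ite_mul, zero_mul, Finset.sum_ite_eq, Finset.mem_univ, if_true]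
    rw [Finset.sum_comm]
  unfold outputReduced ptraceRight
  rw [Fintype.sum_prod_type]
  simp only [Matrix.reindex_apply, Matrix.submatrix_apply, sortOut, Equiv.coe_fn_symm_mk]
  simp only [h]
  rw [Finset.sum_comm (s := (Finset.univ : Finset (Fin Pr.dY)))]
  refine Finset.sum_congr rfl fun g _ => ?_
  rw [Finset.sum_comm]

end cpb



section cpb2
variable {α β : Type*} [Fintype α] [DecidableEq α] [Fintype β] [DecidableEq β]

lemma cpb_tpowAB_trace (ρ : Matrix (α × β) (α × β) ℂ) (hρ : IsDensity ρ) (n : ℕ) :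
    (tpowAB ρ n).trace = 1 := by
  rw [← cpb_ptraceRight_trace, cpb_ptraceRight_tpowAB]
  simp only [trace, Matrix.diag, tpow]
  have h1 : ∑ i, ptraceRight ρ i i = 1 := by
    have := cpb_ptraceRight_trace ρ
    rw [hρ.2] at this
    exact this
  have := Finset.prod_univ_sum (fun _ : Fin n => (Finset.univ : Finset α))
    (fun _ i => ptraceRight ρ i i)
  rw [Fintype.piFinset_univ] at this
  rw [← this, h1]; simp

lemma cpb_tpowAB_psd (ρ : Matrix (α × β) (α × β) ℂ) (hρ : IsDensity ρ) (n : ℕ) :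
    (tpowAB ρ n).PosSemidef := by
  unfold tpowAB
  rw [Matrix.reindex_apply]
  exact (cpb_tpow_psd ρ n hρ.1).submatrix _

lemma cpb_stateUA_trace {n : ℕ} (ρ : Matrix (α × β) (α × β) ℂ) (hρ : IsDensity ρ)
    (Pr : Protocol α β n) : (stateAfterUA ρ Pr).trace = 1 := by
  rw [cpb_stateUA, ← cpb_ptraceLeft_trace, cpb_ptraceLeft_kron2 _ _ (cpb_J_iso Pr),
    cpb_ptraceLeft_trace, cpb_tpowAB_trace ρ hρ]

lemma cpb_output_trace {n : ℕ} (ρ : Matrix (α × β) (α × β) ℂ) (hρ : IsDensity ρ)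
    (Pr : Protocol α β n) : ∑ x, outputReduced ρ Pr x x = 1 := by
  rw [Fintype.sum_prod_type]
  simp only [cpb_output]
  rw [← cpb_stateUA_trace ρ hρ Pr]
  generalize stateAfterUA ρ Pr = ω
  have h : ∀ (a : Fin Pr.dAp) (y : Fin Pr.dY) (g : Fin Pr.dAg), ∑ p, ∑ q,
      (cpb_L Pr.UB * cpb_blk ω (a, g) * (cpb_L Pr.UB)ᴴ) (y, (p, q)) (y, (p, q))
      = ∑ b, ω (((a, y), g), b) (((a, y), g), b) := by
    intro a y g
    have := cpb_L_sum Pr.UB Pr.UB_unitary.1 (cpb_blk ω (a, g)) y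
    rw [Fintype.sum_prod_type] at this
    rw [this]
    rfl
  simp only [trace, Matrix.diag, Fintype.sum_prod_type]
  refine Finset.sum_congr rfl fun a _ => ?_
  rw [Finset.sum_comm]
  refine Finset.sum_congr rfl fun y _ => ?_
  rw [Finset.sum_comm]
  refine Finset.sum_congr rfl fun g _ => ?_
  exact h a y g

lemma cpb_error {n : ℕ} (ρ : Matrix (α × β) (α × β) ℂ) (hρ : IsDensity ρ)
    (Pr : Protocol α β n) (x0 : Fin Pr.dAp × Fin Pr.dBp) (h1 : x0.1.val = 0) (h2 : x0.2.val = 0) :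
    2 * (1 - (outputReduced ρ Pr x0 x0).re) ≤ protocolError ρ Pr := by
  have hK : (diagonal (fun x => if x = x0 then (-1 : ℂ) else 1)) *
      (diagonal (fun x => if x = x0 then (-1 : ℂ) else 1))ᴴ = 1 := by
    rw [diagonal_conjTranspose, diagonal_mul_diagonal, ← diagonal_one]
    congr 1
    ext x
    by_cases h : x = x0 <;> simp [h]
  have := cpb_traceNorm (diagonal (fun x => if x = x0 then (-1 : ℂ) else 1))
    (outputReduced ρ Pr - pureZero Pr.dAp ⊗ₖ pureZero Pr.dBp) hK
  refine le_trans (le_of_eq ?_) this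
  have hP : ∀ x, (pureZero Pr.dAp ⊗ₖ pureZero Pr.dBp) x x = if x = x0 then 1 else 0 := by
    intro x
    have : x = x0 ↔ x.1.val = 0 ∧ x.2.val = 0 := by
      rw [Prod.ext_iff, Fin.ext_iff, Fin.ext_iff, h1, h2]
    simp only [kroneckerMap_apply, pureZero, this]
    by_cases e1 : x.1.val = 0 <;> by_cases e2 : x.2.val = 0 <;> simp [e1, e2]
  simp only [trace, Matrix.diag, diagonal_mul, Matrix.sub_apply, hP]
  have e : ∀ x, (if x = x0 then (-1 : ℂ) else 1) * (outputReduced ρ Pr x x - if x = x0 then 1 else 0)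
      = outputReduced ρ Pr x x + (if x = x0 then 1 - 2 * outputReduced ρ Pr x x else 0) := by
    intro x
    by_cases h : x = x0
    · simp only [h, if_true]; ring
    · simp [h]
  simp only [e, Finset.sum_add_distrib, cpb_output_trace ρ hρ, Finset.sum_ite_eq',
    Finset.mem_univ, if_true]
  simp
  ring

lemma cpb_ptraceLeft_tau {n : ℕ} (ρ : Matrix (α × β) (α × β) ℂ) (Pr : Protocol α β n) :
    ptraceLeft (ptraceRight (Matrix.reindex
      (pullYB (Fin Pr.dAp) (Fin Pr.dY) (Fin Pr.dAg) (Fin n → β))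
      (pullYB (Fin Pr.dAp) (Fin Pr.dY) (Fin Pr.dAg) (Fin n → β)) (stateAfterUA ρ Pr)))
      = tpow (ptraceLeft ρ) n := by
  rw [← cpb_ptraceLeft_tpowAB, ← cpb_ptraceLeft_kron2 _ _ (cpb_J_iso Pr), ← cpb_stateUA]
  ext b b'
  simp only [ptraceLeft, ptraceRight, Matrix.reindex_apply, Matrix.submatrix_apply, pullYB,
    Equiv.coe_fn_symm_mk, Fintype.sum_prod_type]
  rw [Finset.sum_comm]

lemma cpb_card_eq {ι κ : Type*} [Fintype ι] [DecidableEq ι] [Fintype κ] [DecidableEq κ]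
    (U : Matrix κ ι ℂ) (h : Uᴴ * U = 1 ∧ U * Uᴴ = 1) :
    (Fintype.card κ : ℝ) = Fintype.card ι := by
  have h1 : (Uᴴ * U).trace = (U * Uᴴ).trace := trace_mul_comm _ _
  rw [h.1, h.2, trace_one, trace_one] at h1
  exact_mod_cast h1.symm

lemma cpb_log_two : Real.log 2 ≤ 2 / Real.exp 1 := by
  rw [le_div_iff₀ (Real.exp_pos 1)]
  have h1 := Real.exp_one_lt_d9
  have h2 := Real.log_two_lt_d9
  have h3 : 0 < Real.log 2 := Real.log_pos (by norm_num)
  nlinarith [Real.exp_pos 1]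

end cpb2

theorem cpb_main {α β : Type*} [Fintype α] [DecidableEq α] [Fintype β]
    [DecidableEq β] (ρ : Matrix (α × β) (α × β) ℂ) (hρ : IsDensity ρ)
    {n : ℕ} (hn : 0 < n) (Pr : Protocol α β n) (ε : ℝ) (hε : protocolError ρ Pr ≤ ε) :
    purityRate Pr ≤ kappa (ptraceRight ρ) + kappa (ptraceLeft ρ) + preDephIYB ρ Pr / n
      + (2 / (Real.exp 1 * n) + ε * Real.log ((Fintype.card α : ℝ) * (Fintype.card β : ℝ))) := by
  have hne : Nonempty (α × β) := by
    by_contra hc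
    rw [not_nonempty_iff] at hc
    have := hρ.2
    simp [trace] at this
  obtain ⟨a', b'⟩ := hne
  haveI : Nonempty α := ⟨a'⟩
  haveI : Nonempty β := ⟨b'⟩
  haveI : Nonempty (Fin Pr.dAg) := ⟨⟨0, Pr.dAg_pos⟩⟩
  haveI : Nonempty (Fin Pr.dBg) := ⟨⟨0, Pr.dBg_pos⟩⟩
  have hcore := cpb_core (tpowAB ρ n) (cpb_tpowAB_psd ρ hρ n) (cpb_tpowAB_trace ρ hρ n)
    (cpb_J Pr) (cpb_J_iso Pr) Pr.UB Pr.UB_unitary.1 Pr.UB_unitary.2 (stateAfterUA ρ Pr)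
    (cpb_stateUA ρ Pr) ⟨0, Pr.dAp_pos⟩ ⟨0, Pr.dBp_pos⟩
    (outputReduced ρ Pr (⟨0, Pr.dAp_pos⟩, ⟨0, Pr.dBp_pos⟩) (⟨0, Pr.dAp_pos⟩, ⟨0, Pr.dBp_pos⟩)).re
    (by rw [cpb_output]; simp only [Complex.re_sum])
  have herr := (cpb_error ρ hρ Pr (⟨0, Pr.dAp_pos⟩, ⟨0, Pr.dBp_pos⟩) rfl rfl).trans hε
  rw [cpb_ptraceRight_tpowAB, cpb_entropy_tpow _ n (cpb_ptraceRight_psd ρ hρ.1)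
    (by rw [cpb_ptraceRight_trace, hρ.2])] at hcore
  have hI : preDephIYB ρ Pr = _ := rfl
  unfold preDephIYB mutualInfo
  rw [cpb_ptraceLeft_tau, cpb_entropy_tpow _ n (cpb_ptraceLeft_psd ρ hρ.1)
    (by rw [cpb_ptraceLeft_trace, hρ.2])]
  have hcA := cpb_card_eq Pr.UA Pr.UA_unitary
  have hcB := cpb_card_eq Pr.UB Pr.UB_unitary
  simp only [Fintype.card_prod, Fintype.card_fin, Fintype.card_fun, Nat.cast_mul,
    Nat.cast_pow] at hcA hcB hcore
  have hAp : (Pr.dAp : ℝ) ≠ 0 := by exact_mod_cast Pr.dAp_pos.ne'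
  have hAg : (Pr.dAg : ℝ) ≠ 0 := by exact_mod_cast Pr.dAg_pos.ne'
  have hY : (Pr.dY : ℝ) ≠ 0 := by exact_mod_cast Pr.dY_pos.ne'
  have hC : (Pr.dC : ℝ) ≠ 0 := by exact_mod_cast Pr.dC_pos.ne'
  have hBp : (Pr.dBp : ℝ) ≠ 0 := by exact_mod_cast Pr.dBp_pos.ne'
  have hBg : (Pr.dBg : ℝ) ≠ 0 := by exact_mod_cast Pr.dBg_pos.ne'
  have hα : (1 : ℝ) ≤ Fintype.card α := by exact_mod_cast Fintype.card_pos
  have hβ : (1 : ℝ) ≤ Fintype.card β := by exact_mod_cast Fintype.card_pos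
  have hα0 : (Fintype.card α : ℝ) ≠ 0 := by positivity
  have hβ0 : (Fintype.card β : ℝ) ≠ 0 := by positivity
  have hlA := congrArg Real.log hcA
  have hlB := congrArg Real.log hcB
  rw [Real.log_mul (mul_ne_zero hAp hY) hAg, Real.log_mul hAp hY,
    Real.log_mul (pow_ne_zero _ hα0) hC, Real.log_pow] at hlA
  rw [Real.log_mul hBp hBg, Real.log_mul (pow_ne_zero _ hβ0) hY, Real.log_pow] at hlB
  rw [Real.log_mul hAg hBg, Real.log_mul (pow_ne_zero _ hα0) (pow_ne_zero _ hβ0), Real.log_pow,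
    Real.log_pow] at hcore
  unfold purityRate kappa
  rw [Real.log_mul hAp hBp, Real.log_mul hα0 hβ0]
  have hn0 : (0 : ℝ) < n := by exact_mod_cast hn
  have hlα : 0 ≤ Real.log (Fintype.card α) := Real.log_nonneg hα
  have hlβ : 0 ≤ Real.log (Fintype.card β) := Real.log_nonneg hβ
  have h2 := cpb_log_two
  have h3 := mul_le_mul_of_nonneg_right herr
    (show 0 ≤ n * Real.log (Fintype.card α) + n * Real.log (Fintype.card β) by positivity)
  set HA := entropy (ptraceRight ρ)
  set HB := entropy (ptraceLeft ρ)
  rw [div_le_iff₀ hn0]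
  have e1 : ∀ I : ℝ, (Real.log (Fintype.card α) - HA + (Real.log (Fintype.card β) - HB) + I / n
      + (2 / (Real.exp 1 * n) + ε * (Real.log (Fintype.card α) + Real.log (Fintype.card β)))) * n
      = n * Real.log (Fintype.card α) - n * HA + n * Real.log (Fintype.card β) - n * HB + I
        + 2 / Real.exp 1
        + ε * (n * Real.log (Fintype.card α) + n * Real.log (Fintype.card β)) := by
    intro I
    have := Real.exp_pos 1
    field_simp
    ring
  rw [e1]
  linarith


/-- **Converse purity-rate bound.** For any `(n,R,P,ε)` protocol, with
`δ = 2/(en) + ε log(d_A d_B)` and the mutual information evaluated on the pre-dephasing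
state `U_A((ρ^{AB})^{⊗n} ⊗ |0⟩⟨0|^C)`,
`P ≤ κ(ρ^A) + κ(ρ^B) + (1/n) I(Y;B^n) + δ`. -/
theorem converse_purity_rate_bound {α β : Type*} [Fintype α] [DecidableEq α] [Fintype β]
    [DecidableEq β] (ρ : Matrix (α × β) (α × β) ℂ) (hρ : IsDensity ρ)
    {n : ℕ} (hn : 0 < n) (Pr : Protocol α β n) (ε : ℝ) (hε : protocolError ρ Pr ≤ ε) :
    purityRate Pr ≤ kappa (ptraceRight ρ) + kappa (ptraceLeft ρ)
      + preDephIYB ρ Pr / n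
      + (2 / (Real.exp 1 * n)
          + ε * Real.log ((Fintype.card α : ℝ) * (Fintype.card β : ℝ))) := by
  exact cpb_main ρ hρ hn Pr ε hε

end LPD
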